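/- Let N ≥ 2, s ∈ (0,1), x_0 ∈ ℝ^N, r > 0, ρ ∈ (0,1), and let V, f ∈ L^∞(B_r(x_0)). Let u ∈ L¹(ℝ^N, dx/(1+|x|^{N+2s})) satisfy ∫_{ℝ^N} u (−Δ)^s φ dx + ∫_{B_r(x_0)} V u φ dx = ∫_{B_r(x_0)} f φ dx for all φ ∈ C^∞_c(B_r(x_0)). Then u ∈ L^∞(B_{ρr}(x_0)) and ‖u‖_{L^∞(B_{ρr}(x_0))} ≤ C ( ‖f‖_{L^∞(B_r(x_0))} + ‖u‖_{L¹(ℝ^N, dx/(1+|x|^{N+2s}))} ) with a constant C > 0 depending only on N, s, V, r, and ρ. -/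

import Mathlib

open MeasureTheory Filter Set Topology Metric

noncomputable section

/-- Euclidean space `ℝ^N`. -/
abbrev EN (N : ℕ) := EuclideanSpace ℝ (Fin N)

/-- The normalizing constant `C_{N,s}` of the fractional Laplacian. -/
def CNs (N : ℕ) (s : ℝ) : ℝ :=
  2 ^ (2*s) * Real.pi ^ (-(N:ℝ)/2) * s * Real.Gamma ((N + 2*s)/2) / Real.Gamma (1 - s)

/-- The optimal fractional Hardy constant `μ₀`. -/
def mu0 (N : ℕ) (s : ℝ) : ℝ :=
  -(2 ^ (2*s) * Real.Gamma ((N + 2*s)/4) ^ 2 / Real.Gamma ((N - 2*s)/4) ^ 2)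

/-- The function `τ ↦ c_s(τ)`. -/
def csFun (N : ℕ) (s τ : ℝ) : ℝ :=
  2 ^ (2*s) * Real.Gamma ((N + τ)/2) * Real.Gamma ((2*s - τ)/2) /
    (Real.Gamma (-τ/2) * Real.Gamma ((N - 2*s + τ)/2))

/-- `u` has fractional Laplacian `(-Δ)^s u (x) = L` at `x`, as a principal value. -/
def HasFracLap (N : ℕ) (s : ℝ) (u : EN N → ℝ) (x : EN N) (L : ℝ) : Prop :=
  Tendsto (fun ε : ℝ =>
      CNs N s * ∫ z in {z : EN N | ε ≤ dist x z}, (u x - u z) / dist x z ^ ((N:ℝ) + 2*s))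
    (𝓝[>] 0) (𝓝 L)

/-- `v` has weighted fractional Laplacian `(-Δ)^s_{Γ_μ} v (x) = L` at `x`, where the weight
is `Γ_μ(z) = ‖z‖ ^ τp` with `τp = τ₊(s,μ)`. -/
def HasWFracLap (N : ℕ) (s τp : ℝ) (v : EN N → ℝ) (x : EN N) (L : ℝ) : Prop :=
  Tendsto (fun ε : ℝ =>
      CNs N s * ∫ z in {z : EN N | ε ≤ dist x z},
        (v x - v z) * ‖z‖ ^ τp / dist x z ^ ((N:ℝ) + 2*s))
    (𝓝[>] 0) (𝓝 L)

/-- Membership in `L¹(ℝ^N, dx/(1+|x|^{N+2s}))`. -/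
def MemL1w (N : ℕ) (s : ℝ) (u : EN N → ℝ) : Prop :=
  Integrable (fun x : EN N => u x / (1 + ‖x‖ ^ ((N:ℝ) + 2*s)))

/-- Membership in `L^∞_loc(ℝ^N \ {0})`. -/
def LocBddAway (N : ℕ) (u : EN N → ℝ) : Prop :=
  ∀ K : Set (EN N), IsCompact K → (0:EN N) ∉ K → ∃ C : ℝ, ∀ x ∈ K, |u x| ≤ C

/-- Local `θ`-Hölder continuity on compact subsets of `S`, i.e. `C^θ_loc(S)`. -/
def HolderLocOn (N : ℕ) (θ : ℝ) (f : EN N → ℝ) (S : Set (EN N)) : Prop :=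
  ∀ K ⊆ S, IsCompact K → ∃ C : ℝ, ∀ x ∈ K, ∀ y ∈ K, |f x - f y| ≤ C * dist x y ^ θ

/-- Membership in `L^∞_loc(S)`. -/
def LinfLocOn (N : ℕ) (f : EN N → ℝ) (S : Set (EN N)) : Prop :=
  AEMeasurable f ∧ ∀ K ⊆ S, IsCompact K → ∃ C : ℝ, ∀ x ∈ K, |f x| ≤ C

/-- A bounded `C²` domain: open, connected and bounded, whose boundary is the regular zero
level set of a `C²` defining function. -/
structure IsBoundedC2Domain (N : ℕ) (Ω : Set (EN N)) : Prop where
  isOpen : IsOpen Ω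
  isConnected : IsConnected Ω
  isBounded : Bornology.IsBounded Ω
  c2Boundary : ∃ φ : EN N → ℝ, ContDiff ℝ 2 φ ∧ Ω = {x | φ x < 0} ∧
    ∀ x ∈ frontier Ω, fderiv ℝ φ x ≠ 0

/-- A bounded domain: open, connected and bounded. -/
def IsBoundedDomain (N : ℕ) (Ω : Set (EN N)) : Prop :=
  IsOpen Ω ∧ IsConnected Ω ∧ Bornology.IsBounded Ω

/-- The first standard coordinate vector `e₁ ∈ ℝ^N`. -/
def e1 (N : ℕ) : EN N :=
  (EuclideanSpace.equiv (Fin N) ℝ).symm (fun i => if (i:ℕ) = 0 then 1 else 0)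

/-- The surface measure `ω_{N-1}` of the unit sphere in `ℝ^N`. -/
def omegaN (N : ℕ) : ℝ := N * (volume (ball (0 : EN N) 1)).toReal

/-- The normalization constant `c_{s,0}`. -/
def cs0 (N : ℕ) (s : ℝ) : ℝ :=
  CNs N s * omegaN N * ∫ t in Ioo (0:ℝ) 1, ∫ z in ball (0:EN N) t,
    (‖z‖ ^ (2*s - N) - 1) / ‖e1 N - z‖ ^ ((N:ℝ) + 2*s)

/-- The fundamental solution `Φ_μ`, expressed via the exponent `τ = τ₋(s,μ)`:
`Φ_μ(x) = |x|^τ` for `μ ≠ μ₀` and `Φ_{μ₀}(x) = -|x|^τ ln |x|`. -/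
def Phi (N : ℕ) (s μ τ : ℝ) (x : EN N) : ℝ :=
  if μ = mu0 N s then -(‖x‖ ^ τ * Real.log ‖x‖) else ‖x‖ ^ τ

/-- The integrand appearing in the definition of `c_{s,μ}`. -/
def cIntegrand (N : ℕ) (s μ τm τp : ℝ) (z : EN N) : ℝ :=
  if μ = mu0 N s then ‖z‖ ^ ((2*s - N)/2) * (-Real.log ‖z‖) / ‖e1 N - z‖ ^ ((N:ℝ) + 2*s)
  else (‖z‖ ^ τm - ‖z‖ ^ τp) / ‖e1 N - z‖ ^ ((N:ℝ) + 2*s)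

/-- The normalization constant `c_{s,μ}`. -/
def csmu (N : ℕ) (s μ τm τp : ℝ) : ℝ :=
  CNs N s * omegaN N * ∫ t in Ioo (0:ℝ) 1, ∫ z in ball (0:EN N) t, cIntegrand N s μ τm τp z

/-- The weight `Λ_μ`, expressed via `τp = τ₊(s,μ)`. -/
def Lam (N : ℕ) (s τp : ℝ) (x : EN N) : ℝ :=
  if 2*s - 1 < τp then 1
  else if τp < 2*s - 1 then ‖x‖ ^ (1 - 2*s + τp)
  else 1 + max (-Real.log ‖x‖) 0

/-- The quadratic form `E^s(u,v)`. -/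
def Es (N : ℕ) (s : ℝ) (u v : EN N → ℝ) : ℝ :=
  (CNs N s / 2) *
    ∫ p : EN N × EN N, (u p.1 - u p.2) * (v p.1 - v p.2) / dist p.1 p.2 ^ ((N:ℝ) + 2*s)

/-- The quadratic form `E^s_μ(u,v)`. -/
def Esmu (N : ℕ) (s μ : ℝ) (u v : EN N → ℝ) : ℝ :=
  Es N s u v + μ * ∫ x : EN N, u x * v x / ‖x‖ ^ (2*s)

/-- `E^s_{A,B}(u,u) < ∞`. -/
def FiniteEnergyOn (N : ℕ) (s : ℝ) (u : EN N → ℝ) (A B : Set (EN N)) : Prop :=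
  IntegrableOn (fun p : EN N × EN N => (u p.1 - u p.2)^2 / dist p.1 p.2 ^ ((N:ℝ) + 2*s)) (A ×ˢ B)

/-- Membership in `H^s(ℝ^N)`: locally `L²` with finite Gagliardo seminorm. -/
def MemHs (N : ℕ) (s : ℝ) (u : EN N → ℝ) : Prop :=
  (∀ K : Set (EN N), IsCompact K → IntegrableOn (fun x => (u x)^2) K) ∧
  FiniteEnergyOn N s u univ univ

/-- Membership in `H^s_0(Ω)`. -/
def MemHs0 (N : ℕ) (s : ℝ) (Ω : Set (EN N)) (u : EN N → ℝ) : Prop :=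
  MemHs N s u ∧ ∀ᵐ x : EN N, x ∉ Ω → u x = 0

/-- Membership in `W^s(Ω)`. -/
def MemWs (N : ℕ) (s : ℝ) (Ω : Set (EN N)) (u : EN N → ℝ) : Prop :=
  MemL1w N s u ∧ IntegrableOn (fun x => (u x)^2) Ω ∧
  ∃ Ω' : Set (EN N), IsOpen Ω' ∧ IsConnected Ω' ∧ closure Ω ⊆ Ω' ∧ FiniteEnergyOn N s u Ω Ω'

/-- Membership in `W^s_*(Ω)`. -/
def MemWsStar (N : ℕ) (s : ℝ) (Ω : Set (EN N)) (u : EN N → ℝ) : Prop :=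
  MemL1w N s u ∧ ∀ ε : ℝ, 0 < ε → MemWs N s (Ω \ closedBall 0 ε) u

/-- The distributional identity `L^s_μ u = f` in `Ω \ {0}`, tested against `C^∞_c(Ω\{0})`. -/
def DistrEq (N : ℕ) (s μ : ℝ) (Ω : Set (EN N)) (f u : EN N → ℝ) : Prop :=
  ∀ φ : EN N → ℝ, ContDiff ℝ (⊤ : ℕ∞) φ → HasCompactSupport φ → tsupport φ ⊆ Ω \ {0} →
    ∀ g : EN N → ℝ, (∀ x, HasFracLap N s φ x (g x)) →
      (∫ x, u x * g x) + μ * ∫ x, u x * φ x / ‖x‖ ^ (2*s) = ∫ x in Ω, f x * φ x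

/-- A distributional solution of `L^s_μ u = f` in `Ω \ {0}` with `u = 0` in `ℝ^N \ Ω`. -/
def IsDistrSol (N : ℕ) (s μ : ℝ) (Ω : Set (EN N)) (f u : EN N → ℝ) : Prop :=
  LocBddAway N u ∧ MemL1w N s u ∧ (∀ x ∉ Ω, u x = 0) ∧ DistrEq N s μ Ω f u


theorem EN_nontrivial (N : ℕ) (hN : 2 ≤ N) : Nontrivial (EN N) := by
  have : Nonempty (Fin N) := ⟨⟨0, by omega⟩⟩
  infer_instance

theorem pow_mul_rpow_aux {N : ℕ} (hN : 2 ≤ N) {y : ℝ} (hy : 0 < y) (b : ℝ) :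
    y ^ (N - 1) * y ^ b = y ^ ((N:ℝ) - 1 + b) := by
  rw [← Real.rpow_natCast, ← Real.rpow_add hy]
  congr 2
  rw [Nat.cast_sub (by omega)]; simp

theorem int_near (N : ℕ) (hN : 2 ≤ N) (β t : ℝ) (ht : 0 < t) (hβ : β < N) :
    IntegrableOn (fun y : EN N => ‖y‖ ^ (-β)) (ball 0 t) := by
  have := EN_nontrivial N hN
  rw [integrableOn_fun_norm_addHaar (μ := volume) (f := fun t => t ^ (-β))]
  have h := (intervalIntegral.integrableOn_Ioo_rpow_iff (s := (N:ℝ) - 1 + -β) ht).2 (by linarith)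
  refine h.congr_fun ?_ measurableSet_Ioo
  intro y hy
  simp only [finrank_euclideanSpace, Fintype.card_fin, smul_eq_mul]
  rw [pow_mul_rpow_aux hN hy.1]

theorem far_eq (N : ℕ) (t β : ℝ) : (fun x : EN N => (Ioi t).indicator (fun y : ℝ => y ^ (-β)) ‖x‖) =
    (closedBall (0:EN N) t)ᶜ.indicator (fun y : EN N => ‖y‖ ^ (-β)) := by
  ext x
  simp [indicator]

theorem int_far (N : ℕ) (hN : 2 ≤ N) (β t : ℝ) (ht : 0 < t) (hβ : (N:ℝ) < β) :
    IntegrableOn (fun y : EN N => ‖y‖ ^ (-β)) (closedBall 0 t)ᶜ := by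
  have := EN_nontrivial N hN
  rw [← integrable_indicator_iff isClosed_closedBall.measurableSet.compl, ← far_eq]
  rw [integrable_fun_norm_addHaar (μ := volume) (f := (Ioi t).indicator (fun y : ℝ => y ^ (-β)))]
  have h := (integrableOn_Ioi_rpow_of_lt (a := (N:ℝ) - 1 + -β) (by linarith) ht)
  rw [← integrable_indicator_iff measurableSet_Ioi] at h
  refine h.integrableOn.congr_fun ?_ measurableSet_Ioi
  intro y hy
  simp only [finrank_euclideanSpace, Fintype.card_fin, smul_eq_mul]
  by_cases hyt : y ∈ Ioi t
  · simp only [indicator_of_mem hyt]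
    rw [pow_mul_rpow_aux hN hy]
  · simp only [indicator_of_notMem hyt, mul_zero]

theorem integral_far (N : ℕ) (hN : 2 ≤ N) (β t : ℝ) (ht : 0 < t) (hβ : (N:ℝ) < β) :
    ∫ y in (closedBall (0 : EN N) t)ᶜ, ‖y‖ ^ (-β) = omegaN N * (t ^ ((N:ℝ)-β) / (β - N)) := by
  have := EN_nontrivial N hN
  rw [← integral_indicator isClosed_closedBall.measurableSet.compl, ← far_eq]
  rw [integral_fun_norm_addHaar (μ := volume) (f := (Ioi t).indicator (fun y : ℝ => y ^ (-β)))]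
  have : ∫ (y : ℝ) in Ioi 0, y ^ (Module.finrank ℝ (EN N) - 1) • (Ioi t).indicator (fun y ↦ y ^ (-β)) y
      = ∫ y in Ioi t, y ^ ((N:ℝ) - 1 + -β) := by
    rw [← integral_indicator measurableSet_Ioi, ← integral_indicator measurableSet_Ioi]
    congr 1
    ext y
    simp only [finrank_euclideanSpace, Fintype.card_fin, smul_eq_mul, indicator, mem_Ioi]
    by_cases h1 : t < y
    · have h2 : 0 < y := ht.trans h1
      simp [h1, h2, pow_mul_rpow_aux hN h2]
    · simp [h1]
  rw [this, integral_Ioi_rpow_of_lt (by linarith) ht]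
  simp only [finrank_euclideanSpace, Fintype.card_fin, nsmul_eq_mul, smul_eq_mul, omegaN, Measure.real]
  have h1 : (N:ℝ) - 1 + -β + 1 = N - β := by ring
  rw [h1]
  have : (N:ℝ) - β ≠ 0 := by linarith
  have : β - N ≠ 0 := by linarith
  rw [show β - (N:ℝ) = -(N-β) by ring]
  field_simp

theorem omegaN_pos (N : ℕ) (hN : 2 ≤ N) : 0 < omegaN N := by
  unfold omegaN
  have : 0 < (volume (ball (0 : EN N) 1)).toReal :=
    ENNReal.toReal_pos (measure_ball_pos _ _ one_pos).ne' measure_ball_lt_top.ne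
  have : (0:ℝ) < N := by exact_mod_cast (by omega : 0 < N)
  positivity

/-- kernel weight with quadratic cutoff -/
theorem int_min (N : ℕ) (hN : 2 ≤ N) (s : ℝ) (hs : s ∈ Ioo (0:ℝ) 1) :
    Integrable (fun y : EN N => min (‖y‖ ^ 2) 1 / ‖y‖ ^ ((N:ℝ) + 2*s)) := by
  have hm : Measurable (fun y : EN N => min (‖y‖ ^ 2) 1 / ‖y‖ ^ ((N:ℝ) + 2*s)) := by fun_prop
  have h1 : IntegrableOn (fun y : EN N => min (‖y‖ ^ 2) 1 / ‖y‖ ^ ((N:ℝ) + 2*s)) (ball 0 2) := by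
    refine (int_near N hN ((N:ℝ) + 2*s - 2) 2 (by norm_num) (by linarith [hs.2])).mono'
      hm.aestronglyMeasurable ?_
    refine Eventually.of_forall fun y => ?_
    rcases eq_or_ne y 0 with rfl | hy
    · have : (0:ℝ) ≤ 0 ^ (-((N:ℝ) + 2*s - 2)) := Real.rpow_nonneg le_rfl _
      simpa using this
    · have hy' : 0 < ‖y‖ := norm_pos_iff.2 hy
      have e : ‖y‖ ^ (-((N:ℝ) + 2*s - 2)) = ‖y‖ ^ 2 / ‖y‖ ^ ((N:ℝ) + 2*s) := by
        rw [← Real.rpow_natCast, ← Real.rpow_sub hy']; congr 1; push_cast; ring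
      rw [e, Real.norm_of_nonneg (by positivity)]
      gcongr
      exact min_le_left _ _
  have h2 : IntegrableOn (fun y : EN N => min (‖y‖ ^ 2) 1 / ‖y‖ ^ ((N:ℝ) + 2*s)) (closedBall 0 1)ᶜ := by
    refine (int_far N hN ((N:ℝ) + 2*s) 1 (by norm_num) (by linarith [hs.1])).mono'
      hm.aestronglyMeasurable ?_
    refine Eventually.of_forall fun y => ?_
    rw [Real.norm_of_nonneg (by positivity), Real.rpow_neg (norm_nonneg _), div_eq_mul_inv]
    have : min (‖y‖ ^ 2) 1 ≤ 1 := min_le_right _ _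
    have h0 : 0 ≤ (‖y‖ ^ ((N:ℝ) + 2*s))⁻¹ := by positivity
    nlinarith
  rw [← integrableOn_univ]
  refine (h1.union h2).mono_set ?_
  intro y _
  by_cases h : ‖y‖ < 2
  · left; simpa using h
  · right; simp; linarith

theorem int_weight (N : ℕ) (hN : 2 ≤ N) (s : ℝ) (hs : s ∈ Ioo (0:ℝ) 1) :
    Integrable (fun y : EN N => 1 / (1 + ‖y‖ ^ ((N:ℝ) + 2*s))) := by
  have hm : Measurable (fun y : EN N => 1 / (1 + ‖y‖ ^ ((N:ℝ) + 2*s))) := by fun_prop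
  have h1 : IntegrableOn (fun y : EN N => 1 / (1 + ‖y‖ ^ ((N:ℝ) + 2*s))) (closedBall 0 1) := by
    refine (integrableOn_const (C := (1:ℝ)) (isCompact_closedBall (0:EN N) 1).measure_lt_top.ne).mono'
      hm.aestronglyMeasurable ?_
    refine Eventually.of_forall fun y => ?_
    have h0 : 0 ≤ ‖y‖ ^ ((N:ℝ) + 2*s) := by positivity
    rw [Real.norm_of_nonneg (by positivity), div_le_one (by positivity)]
    linarith
  have h2 : IntegrableOn (fun y : EN N => 1 / (1 + ‖y‖ ^ ((N:ℝ) + 2*s))) (closedBall 0 1)ᶜ := by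
    refine (int_far N hN ((N:ℝ) + 2*s) 1 (by norm_num) (by linarith [hs.1])).mono'
      hm.aestronglyMeasurable ?_
    refine (ae_restrict_mem isClosed_closedBall.measurableSet.compl).mono fun y hy => ?_
    have hy1 : 1 < ‖y‖ := by simpa using hy
    rw [Real.norm_of_nonneg (by positivity), Real.rpow_neg (norm_nonneg _), ← one_div]
    gcongr
    linarith
  rw [← integrableOn_univ, ← union_compl_self (closedBall (0:EN N) 1)]
  exact h1.union h2

theorem CNs_pos (N : ℕ) (s : ℝ) (hs : s ∈ Ioo (0:ℝ) 1) : 0 < CNs N s := by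
  unfold CNs
  have := hs.1
  have h1 : 0 < Real.Gamma ((N + 2*s)/2) := Real.Gamma_pos_of_pos (by positivity)
  have h2 : 0 < Real.Gamma (1 - s) := Real.Gamma_pos_of_pos (by linarith [hs.2])
  have := Real.pi_pos
  positivity

/-- second difference -/
def sd {N : ℕ} (φ : EN N → ℝ) (x y : EN N) : ℝ := 2 * φ x - φ (x + y) - φ (x - y)

/-- symmetrized fractional Laplacian -/
def Lsym (N : ℕ) (s : ℝ) (φ : EN N → ℝ) (x : EN N) : ℝ :=
  CNs N s / 2 * ∫ y : EN N, sd φ x y / ‖y‖ ^ ((N:ℝ) + 2*s)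

theorem sd_bound {N : ℕ} (φ : EN N → ℝ) (h1 : ContDiff ℝ (⊤ : ℕ∞) φ) (h2 : HasCompactSupport φ) :
    ∃ B : ℝ, 0 ≤ B ∧ (∀ x, |φ x| ≤ B) ∧ ∀ x y, |sd φ x y| ≤ B * min (‖y‖ ^ 2) 1 := by
  obtain ⟨M, hM⟩ := h2.exists_bound_of_continuous h1.continuous
  obtain ⟨L, hL⟩ := ContDiff.lipschitzWith_of_hasCompactSupport (𝕂 := ℝ) (n := 1) (f := fderiv ℝ φ)
    (h2.fderiv ℝ) (h1.fderiv_right (by norm_cast)) (by simp)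
  have hM0 : 0 ≤ M := (norm_nonneg _).trans (hM 0)
  have hd : Differentiable ℝ φ := h1.differentiable (by simp)
  have key : ∀ x y : EN N, |φ (x + y) - φ x - fderiv ℝ φ x y| ≤ L * ‖y‖ ^ 2 := by
    intro x y
    have := Convex.norm_image_sub_le_of_norm_fderiv_le (𝕜 := ℝ) (f := fun z => φ z - fderiv ℝ φ x z)
      (C := L * ‖y‖) (s := closedBall x ‖y‖) (x := x) (y := x + y)
      (fun z _ => (hd z).sub (fderiv ℝ φ x).differentiableAt)
      (fun z hz => ?_) (convex_closedBall _ _) (by simp) (by simp)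
    · rw [Real.norm_eq_abs] at this
      convert this using 1
      · congr 1; simp [map_add]; ring
      · simp; ring
    · rw [fderiv_fun_sub (hd z) (fderiv ℝ φ x).differentiableAt, ContinuousLinearMap.fderiv]
      have := hL.norm_sub_le z x
      refine this.trans ?_
      gcongr
      simpa [dist_eq_norm] using hz
  refine ⟨4 * M + 2 * L, by positivity, fun x => ?_, fun x y => ?_⟩
  · have := hM x
    rw [Real.norm_eq_abs] at this
    have : (0:ℝ) ≤ L := L.2
    linarith
  · have hL0 : (0:ℝ) ≤ L := L.2
    have a1 : |sd φ x y| ≤ 2 * L * ‖y‖ ^ 2 := by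
      have k1 := abs_le.1 (key x y)
      have k2 := abs_le.1 (key x (-y))
      simp only [norm_neg, map_neg, ← sub_eq_add_neg] at k2
      unfold sd
      rw [abs_le]
      constructor <;> linarith [k1.1, k1.2, k2.1, k2.2]
    have a2 : |sd φ x y| ≤ 4 * M := by
      have k1 := abs_le.1 (hM x)
      have k2 := abs_le.1 (hM (x+y))
      have k3 := abs_le.1 (hM (x-y))
      unfold sd
      rw [abs_le]
      constructor <;> linarith [k1.1, k1.2, k2.1, k2.2, k3.1, k3.2]
    rcases le_total (‖y‖^2) 1 with h | h
    · rw [min_eq_left h]; nlinarith [sq_nonneg ‖y‖]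
    · rw [min_eq_right h]; linarith

theorem sd_meas {N : ℕ} (s : ℝ) (φ : EN N → ℝ) (h1 : Continuous φ) (x : EN N) :
    Measurable (fun y : EN N => sd φ x y / ‖y‖ ^ ((N:ℝ) + 2*s)) := by
  have : Continuous (fun y => sd φ x y) := by unfold sd; fun_prop
  exact this.measurable.div (by fun_prop)

theorem sd_integrable {N : ℕ} (hN : 2 ≤ N) (s : ℝ) (hs : s ∈ Ioo (0:ℝ) 1) (φ : EN N → ℝ)
    (h1 : Continuous φ) {B : ℝ} (hB : ∀ x y, |sd φ x y| ≤ B * min (‖y‖ ^ 2) 1) (x : EN N) :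
    Integrable (fun y : EN N => sd φ x y / ‖y‖ ^ ((N:ℝ) + 2*s)) := by
  refine ((int_min N hN s hs).const_mul B).mono' (sd_meas s φ h1 x).aestronglyMeasurable ?_
  refine Eventually.of_forall fun y => ?_
  rw [norm_div, Real.norm_eq_abs, Real.norm_of_nonneg (by positivity : 0 ≤ ‖y‖ ^ ((N:ℝ) + 2*s)),
    ← mul_div_assoc]
  gcongr
  exact hB x y

theorem hasFracLap_Lsym (N : ℕ) (hN : 2 ≤ N) (s : ℝ) (hs : s ∈ Ioo (0:ℝ) 1) (φ : EN N → ℝ)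
    (h1 : ContDiff ℝ (⊤ : ℕ∞) φ) (h2 : HasCompactSupport φ) (x : EN N) :
    HasFracLap N s φ x (Lsym N s φ x) := by
  obtain ⟨B, hB0, hφB, hB⟩ := sd_bound φ h1 h2
  have hc := h1.continuous
  have hIntg := sd_integrable hN s hs φ hc hB x
  set p : ℝ := (N:ℝ) + 2*s with hp
  have hmS : ∀ ε : ℝ, MeasurableSet {y : EN N | ε ≤ ‖y‖} := fun ε =>
    (isClosed_le continuous_const continuous_norm).measurableSet
  -- symmetrization
  have hsym : ∀ ε : ℝ, 0 < ε →
      ∫ z in {z : EN N | ε ≤ dist x z}, (φ x - φ z) / dist x z ^ p =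
      (1/2) * ∫ y, {y : EN N | ε ≤ ‖y‖}.indicator (fun y => sd φ x y / ‖y‖ ^ p) y := by
    intro ε hε
    have hmZ : MeasurableSet {z : EN N | ε ≤ dist x z} :=
      (isClosed_le continuous_const (by fun_prop)).measurableSet
    set F : EN N → ℝ := {y : EN N | ε ≤ ‖y‖}.indicator (fun y => (φ x - φ (x + y)) / ‖y‖ ^ p) with hF
    have e1 : ∫ z in {z : EN N | ε ≤ dist x z}, (φ x - φ z) / dist x z ^ p = ∫ y, F y := by
      rw [← integral_indicator hmZ, ← integral_add_left_eq_self _ x]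
      congr 1
      ext y
      simp [hF, indicator]
    have hFi : Integrable F := by
      rw [hF, integrable_indicator_iff (hmS ε)]
      have hs2 : IntegrableOn (fun y : EN N => ‖y‖ ^ (-p)) {y : EN N | ε ≤ ‖y‖} := by
        refine (int_far N hN p (ε/2) (by linarith) (by rw [hp]; linarith [hs.1])).mono_set ?_
        intro y hy
        simp at hy ⊢
        linarith
      refine (hs2.const_mul (2*B)).mono' ?_ ?_
      · refine Measurable.aestronglyMeasurable ?_
        exact (by fun_prop : Continuous fun y => φ x - φ (x + y)).measurable.div (by fun_prop)
      · refine Eventually.of_forall fun y => ?_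
        rw [norm_div, Real.norm_eq_abs, Real.norm_of_nonneg (by positivity : 0 ≤ ‖y‖ ^ p),
          Real.rpow_neg (norm_nonneg _), div_eq_mul_inv]
        gcongr
        have k1 := abs_le.1 (hφB x)
        have k2 := abs_le.1 (hφB (x+y))
        rw [abs_le]
        constructor <;> linarith [k1.1, k1.2, k2.1, k2.2]
    have e2 : ∫ y, F y = ∫ y, F (-y) := (integral_neg_eq_self F volume).symm
    have e3 : ∫ y, {y : EN N | ε ≤ ‖y‖}.indicator (fun y => sd φ x y / ‖y‖ ^ p) y
        = (∫ y, F y) + ∫ y, F (-y) := by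
      rw [← integral_add hFi hFi.comp_neg]
      congr 1
      ext y
      simp only [hF, indicator, mem_ofPred_eq, norm_neg]
      split_ifs
      · unfold sd; rw [← sub_eq_add_neg]; ring
      · simp
    rw [e1, e3, ← e2]; ring
  unfold HasFracLap Lsym
  have lim : Tendsto (fun ε : ℝ => ∫ y, {y : EN N | ε ≤ ‖y‖}.indicator (fun y => sd φ x y / ‖y‖ ^ p) y)
      (𝓝[>] 0) (𝓝 (∫ y : EN N, sd φ x y / ‖y‖ ^ p)) := by
    refine tendsto_integral_filter_of_dominated_convergence (fun y => ‖sd φ x y / ‖y‖ ^ p‖) ?_ ?_ hIntg.norm ?_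
    · exact Eventually.of_forall fun ε =>
        ((sd_meas s φ hc x).indicator (hmS ε)).aestronglyMeasurable
    · exact Eventually.of_forall fun ε => Eventually.of_forall fun y => norm_indicator_le_norm_self _ _
    · have := EN_nontrivial N hN
      have : ∀ᵐ y : EN N, y ≠ 0 := by
        simp [ae_iff]
      refine this.mono fun y hy => ?_
      refine tendsto_const_nhds.congr' ?_
      have hy' : 0 < ‖y‖ := norm_pos_iff.2 hy
      filter_upwards [nhdsWithin_le_nhds (Iic_mem_nhds hy')] with ε hε
      rw [indicator_of_mem]
      exact hε
  have := (lim.const_mul (CNs N s / 2))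
  refine this.congr' ?_
  filter_upwards [self_mem_nhdsWithin] with ε hε
  rw [hsym ε hε]; ring


/-- radial bump -/
def bmp (N : ℕ) (a : ℝ) (x : EN N) : ℝ := Real.smoothTransition (1 - ‖x‖ ^ 2 / a ^ 2)

theorem bmp_contDiff (N : ℕ) (a : ℝ) : ContDiff ℝ (⊤ : ℕ∞) (bmp N a) := by
  unfold bmp
  refine Real.smoothTransition.contDiff.comp ?_
  exact contDiff_const.sub ((contDiff_norm_sq ℝ).div_const _)

theorem bmp_nonneg (N : ℕ) (a : ℝ) (x : EN N) : 0 ≤ bmp N a x := Real.smoothTransition.nonneg _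

theorem bmp_le_one (N : ℕ) (a : ℝ) (x : EN N) : bmp N a x ≤ 1 := Real.smoothTransition.le_one _

theorem bmp_zero (N : ℕ) {a : ℝ} (ha : 0 < a) {x : EN N} (h : a ≤ ‖x‖) : bmp N a x = 0 := by
  refine Real.smoothTransition.zero_of_nonpos ?_
  have : 1 ≤ ‖x‖ ^ 2 / a ^ 2 := by
    rw [le_div_iff₀ (by positivity), one_mul]; gcongr
  linarith

theorem bmp_pos (N : ℕ) {a : ℝ} (ha : 0 < a) {x : EN N} (h : ‖x‖ < a) : 0 < bmp N a x := by
  refine Real.smoothTransition.pos_of_pos ?_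
  have : ‖x‖ ^ 2 / a ^ 2 < 1 := by
    rw [div_lt_one (by positivity)]; gcongr
  linarith

theorem bmp_anti (N : ℕ) {a : ℝ} {x y : EN N} (h : ‖x‖ ≤ ‖y‖) : bmp N a y ≤ bmp N a x := by
  refine Real.smoothTransition.monotone ?_
  gcongr

theorem bmp_compact (N : ℕ) {a : ℝ} (ha : 0 < a) : HasCompactSupport (bmp N a) := by
  refine HasCompactSupport.intro (isCompact_closedBall (0 : EN N) a) fun x hx => ?_
  refine bmp_zero N ha ?_
  simp at hx; exact hx.le

theorem bmp_integrable (N : ℕ) {a : ℝ} (ha : 0 < a) : Integrable (bmp N a) :=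
  (bmp_contDiff N a).continuous.integrable_of_hasCompactSupport (bmp_compact N ha)

theorem bmp_int_pos (N : ℕ) {a : ℝ} (ha : 0 < a) : 0 < ∫ x, bmp N a x := by
  rw [integral_pos_iff_support_of_nonneg (fun x => bmp_nonneg N a x) (bmp_integrable N ha)]
  refine (measure_ball_pos volume (0 : EN N) ha).trans_le (measure_mono ?_)
  intro x hx
  simp only [Function.mem_support]
  exact (bmp_pos N ha (by simpa using hx)).ne'

theorem sd_bmp_integrable_x (N : ℕ) {a : ℝ} (ha : 0 < a) (y : EN N) :
    Integrable (fun x => sd (bmp N a) x y) := by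
  have h := bmp_integrable N ha
  unfold sd
  exact ((h.const_mul 2).sub (h.comp_add_right y)).sub (h.comp_sub_right y)

theorem sd_bmp_L1 (N : ℕ) {a : ℝ} (ha : 0 < a) :
    ∃ C : ℝ, 0 ≤ C ∧ ∀ y : EN N, ∫ x, ‖sd (bmp N a) x y‖ ≤ C * min (‖y‖ ^ 2) 1 := by
  obtain ⟨B, hB0, -, hB⟩ := sd_bound (bmp N a) (bmp_contDiff N a) (bmp_compact N ha)
  have h := bmp_integrable N ha
  have hv : 0 ≤ (volume.real (closedBall (0:EN N) (a+1))) := measureReal_nonneg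
  have hI : 0 ≤ ∫ x, bmp N a x := integral_nonneg (fun x => bmp_nonneg N a x)
  refine ⟨B * (volume.real (closedBall (0:EN N) (a+1))) + 4 * ∫ x, bmp N a x, by positivity,
    fun y => ?_⟩
  have hm0 : 0 ≤ min (‖y‖ ^ 2) 1 := by positivity
  rcases le_total ‖y‖ 1 with hy | hy
  · have : ∫ x, ‖sd (bmp N a) x y‖ ≤ ∫ x, (closedBall (0:EN N) (a+1)).indicator (fun _ => B * min (‖y‖ ^ 2) 1) x := by
      refine integral_mono (sd_bmp_integrable_x N ha y).norm ?_ fun x => ?_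
      · rw [integrable_indicator_iff isClosed_closedBall.measurableSet]
        exact integrableOn_const (isCompact_closedBall (0:EN N) _).measure_lt_top.ne
      · by_cases hx : x ∈ closedBall (0:EN N) (a+1)
        · simp only [indicator_of_mem hx]; exact hB x y
        · simp only [indicator_of_notMem hx]
          have hx' : a + 1 < ‖x‖ := by simpa using hx
          have n1 := norm_sub_norm_le x (-y)
          have n2 := norm_sub_norm_le x y
          rw [norm_neg, sub_neg_eq_add] at n1
          unfold sd
          rw [bmp_zero N ha (by linarith), bmp_zero N ha (by linarith : a ≤ ‖x + y‖),
            bmp_zero N ha (by linarith : a ≤ ‖x - y‖)]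
          simp
    refine this.trans ?_
    rw [integral_indicator isClosed_closedBall.measurableSet, setIntegral_const, smul_eq_mul]
    nlinarith [mul_nonneg hI hm0]
  · have hm : min (‖y‖ ^ 2) 1 = 1 := min_eq_right (by nlinarith)
    rw [hm, mul_one]
    have : ∫ x, ‖sd (bmp N a) x y‖ ≤ ∫ x, (2 * bmp N a x + bmp N a (x + y) + bmp N a (x - y)) := by
      refine integral_mono (sd_bmp_integrable_x N ha y).norm
        (((h.const_mul 2).add (h.comp_add_right y)).add (h.comp_sub_right y)) fun x => ?_
      simp only [sd, Real.norm_eq_abs]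
      rw [abs_le]
      constructor <;> linarith [bmp_nonneg N a x, bmp_nonneg N a (x+y), bmp_nonneg N a (x-y)]
    refine this.trans ?_
    rw [integral_add, integral_add, integral_const_mul, integral_add_right_eq_self,
      integral_sub_right_eq_self]
    · nlinarith [mul_nonneg hB0 hv]
    · exact h.const_mul 2
    · exact h.comp_add_right y
    · exact (h.const_mul 2).add (h.comp_add_right y)
    · exact h.comp_sub_right y

theorem sd_prod_meas (N : ℕ) (s a : ℝ) :
    Measurable (fun q : EN N × EN N => sd (bmp N a) q.1 q.2 / ‖q.2‖ ^ ((N:ℝ) + 2*s)) := by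
  have hc := (bmp_contDiff N a).continuous
  have : Continuous (fun q : EN N × EN N => sd (bmp N a) q.1 q.2) := by unfold sd; fun_prop
  exact this.measurable.div (by fun_prop)

theorem sd_prod_integrable (N : ℕ) (hN : 2 ≤ N) (s : ℝ) (hs : s ∈ Ioo (0:ℝ) 1) {a : ℝ} (ha : 0 < a) :
    Integrable (fun q : EN N × EN N => sd (bmp N a) q.1 q.2 / ‖q.2‖ ^ ((N:ℝ) + 2*s))
      (volume.prod volume) := by
  rw [integrable_prod_iff' (sd_prod_meas N s a).aestronglyMeasurable]
  obtain ⟨C, hC0, hC⟩ := sd_bmp_L1 N ha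
  refine ⟨Eventually.of_forall fun y => ?_, ?_⟩
  · exact (sd_bmp_integrable_x N ha y).div_const (‖y‖ ^ ((N:ℝ) + 2*s))
  refine ((int_min N hN s hs).const_mul C).mono' ?_ ?_
  · exact ((sd_prod_meas N s a).norm.stronglyMeasurable.integral_prod_left').aestronglyMeasurable
  · refine Eventually.of_forall fun y => ?_
    rw [Real.norm_of_nonneg (integral_nonneg fun x => norm_nonneg _)]
    simp only [norm_div, integral_div]
    rw [Real.norm_of_nonneg (by positivity : 0 ≤ ‖y‖ ^ ((N:ℝ) + 2*s)), ← mul_div_assoc]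
    gcongr
    exact hC y

/-- h = L bmp -/
def hh (N : ℕ) (s a : ℝ) (x : EN N) : ℝ := Lsym N s (bmp N a) x

theorem hh_meas (N : ℕ) (s a : ℝ) : Measurable (hh N s a) := by
  unfold hh Lsym
  refine Measurable.const_mul ?_ _
  exact (sd_prod_meas N s a).stronglyMeasurable.integral_prod_right'.measurable

theorem hh_integrable (N : ℕ) (hN : 2 ≤ N) (s : ℝ) (hs : s ∈ Ioo (0:ℝ) 1) {a : ℝ} (ha : 0 < a) :
    Integrable (hh N s a) :=
  (sd_prod_integrable N hN s hs ha).integral_prod_left.const_mul _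

theorem hh_setIntegral (N : ℕ) (hN : 2 ≤ N) (s : ℝ) (hs : s ∈ Ioo (0:ℝ) 1) {a : ℝ} (ha : 0 < a)
    (S : Set (EN N)) :
    ∫ x in S, hh N s a x =
      CNs N s / 2 * ∫ y : EN N, (∫ x in S, sd (bmp N a) x y) / ‖y‖ ^ ((N:ℝ) + 2*s) := by
  unfold hh Lsym
  rw [integral_const_mul, integral_integral_swap]
  · simp only [integral_div]
  · refine (sd_prod_integrable N hN s hs ha).mono_measure ?_
    exact Measure.prod_mono Measure.restrict_le_self le_rfl

theorem hh_int_zero (N : ℕ) (hN : 2 ≤ N) (s : ℝ) (hs : s ∈ Ioo (0:ℝ) 1) {a : ℝ} (ha : 0 < a) :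
    ∫ x, hh N s a x = 0 := by
  have := hh_setIntegral N hN s hs ha univ
  simp only [Measure.restrict_univ] at this
  rw [this]
  have : ∀ y : EN N, ∫ x, sd (bmp N a) x y = 0 := by
    intro y
    have h := bmp_integrable N ha
    unfold sd
    rw [integral_sub, integral_sub, integral_const_mul,
      integral_add_right_eq_self, integral_sub_right_eq_self]
    · ring
    · exact h.const_mul 2
    · exact h.comp_add_right y
    · exact (h.const_mul 2).sub (h.comp_add_right y)
    · exact h.comp_sub_right y
  simp [this]

theorem sd_setIntegral_nonneg (N : ℕ) {a : ℝ} (ha : 0 < a) (t : ℝ) (y : EN N) :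
    0 ≤ ∫ x in ball (0:EN N) t, sd (bmp N a) x y := by
  have h := bmp_integrable N ha
  set ζ : EN N → ℝ := (ball (0:EN N) t).indicator (fun _ => 1) with hζ
  have hζm : Measurable ζ := measurable_const.indicator measurableSet_ball
  have hζ1 : ∀ x, ‖ζ x‖ ≤ 1 := fun x => by
    by_cases hx : x ∈ ball (0:EN N) t
    · simp only [hζ, indicator_of_mem hx]; simp
    · simp only [hζ, indicator_of_notMem hx]; simp
  have hA : Integrable (fun x => ζ x * (bmp N a x - bmp N a (x + y))) :=
    (h.sub (h.comp_add_right y)).bdd_mul (c := 1) hζm.aestronglyMeasurable (Eventually.of_forall hζ1)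
  have hB : Integrable (fun x => ζ x * (bmp N a x - bmp N a (x - y))) :=
    (h.sub (h.comp_sub_right y)).bdd_mul (c := 1) hζm.aestronglyMeasurable (Eventually.of_forall hζ1)
  have hB' : Integrable (fun x => ζ (x + y) * (bmp N a (x + y) - bmp N a x)) := by
    have := hB.comp_add_right y
    simpa using this
  have eB : ∫ x, ζ x * (bmp N a x - bmp N a (x - y)) = ∫ x, ζ (x + y) * (bmp N a (x + y) - bmp N a x) := by
    rw [← integral_add_right_eq_self _ y]
    simp
  have e : ∫ x in ball (0:EN N) t, sd (bmp N a) x y =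
      ∫ x, (ζ x - ζ (x + y)) * (bmp N a x - bmp N a (x + y)) := by
    rw [← integral_indicator measurableSet_ball]
    calc _ = ∫ x, (ζ x * (bmp N a x - bmp N a (x + y)) + ζ x * (bmp N a x - bmp N a (x - y))) := by
          congr 1; ext x
          by_cases hx : x ∈ ball (0:EN N) t
          · simp only [hζ, indicator_of_mem hx, sd]; ring
          · simp only [hζ, indicator_of_notMem hx]; ring
      _ = _ := by
          rw [integral_add hA hB, eB, ← integral_add hA hB']
          congr 1; ext x; ring
  rw [e]
  refine integral_nonneg fun x => ?_
  simp only [Pi.zero_apply]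
  by_cases h1 : x ∈ ball (0:EN N) t <;> by_cases h2 : x + y ∈ ball (0:EN N) t
  · simp [hζ, indicator_of_mem h1, indicator_of_mem h2]
  · simp only [hζ, indicator_of_mem h1, indicator_of_notMem h2]
    have : bmp N a (x+y) ≤ bmp N a x := bmp_anti N (by simp at h1 h2; linarith)
    linarith
  · simp only [hζ, indicator_of_notMem h1, indicator_of_mem h2]
    have : bmp N a x ≤ bmp N a (x+y) := bmp_anti N (by simp at h1 h2; linarith)
    linarith
  · simp [hζ, indicator_of_notMem h1, indicator_of_notMem h2]

/-- flux -/
def mm (N : ℕ) (s a t : ℝ) : ℝ := ∫ x in ball (0:EN N) t, hh N s a x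

theorem mm_nonneg (N : ℕ) (hN : 2 ≤ N) (s : ℝ) (hs : s ∈ Ioo (0:ℝ) 1) {a : ℝ} (ha : 0 < a) (t : ℝ) :
    0 ≤ mm N s a t := by
  unfold mm
  rw [hh_setIntegral N hN s hs ha]
  have := CNs_pos N s hs
  refine mul_nonneg (by positivity) (integral_nonneg fun y => ?_)
  exact div_nonneg (sd_setIntegral_nonneg N ha t y) (by positivity)

theorem mm_pos (N : ℕ) (hN : 2 ≤ N) (s : ℝ) (hs : s ∈ Ioo (0:ℝ) 1) {a : ℝ} (ha : 0 < a) {t : ℝ}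
    (hat : a ≤ t) : 0 < mm N s a t := by
  have hnt := EN_nontrivial N hN
  unfold mm
  rw [hh_setIntegral N hN s hs ha]
  have := CNs_pos N s hs
  refine mul_pos (by positivity) ?_
  have hnn : ∀ y : EN N, 0 ≤ (∫ x in ball (0:EN N) t, sd (bmp N a) x y) / ‖y‖ ^ ((N:ℝ) + 2*s) :=
    fun y => div_nonneg (sd_setIntegral_nonneg N ha t y) (by positivity)
  have hi : Integrable (fun y : EN N => (∫ x in ball (0:EN N) t, sd (bmp N a) x y) / ‖y‖ ^ ((N:ℝ) + 2*s)) := by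
    have := ((sd_prod_integrable N hN s hs ha).mono_measure
      (Measure.prod_mono (Measure.restrict_le_self (s := ball (0:EN N) t)) le_rfl)).integral_prod_right
    simpa only [integral_div] using this
  rw [integral_pos_iff_support_of_nonneg hnn hi]
  obtain ⟨v, hv⟩ := exists_ne (0 : EN N)
  have hv' : 0 < ‖v‖ := norm_pos_iff.2 hv
  set w : EN N := ((2 * t + a + 1) / ‖v‖) • v with hw
  have hwn : ‖w‖ = 2 * t + a + 1 := by
    rw [hw, norm_smul, Real.norm_of_nonneg (div_nonneg (by linarith) hv'.le)]; field_simp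
  refine (measure_ball_pos volume w (one_pos)).trans_le (measure_mono ?_)
  intro y hy
  have hy1 : 2 * t + a < ‖y‖ := by
    have h1 : ‖y - w‖ < 1 := by simpa [dist_eq_norm] using hy
    have h2 := norm_sub_norm_le w y
    rw [norm_sub_rev] at h2
    linarith
  have hyp : 0 < ‖y‖ := by linarith
  have e : ∫ x in ball (0:EN N) t, sd (bmp N a) x y = 2 * ∫ x, bmp N a x := by
    have e1 : ∫ x in ball (0:EN N) t, sd (bmp N a) x y = ∫ x in ball (0:EN N) t, 2 * bmp N a x := by
      refine setIntegral_congr_fun measurableSet_ball fun x hx => ?_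
      have hx' : ‖x‖ < t := by simpa using hx
      have n1 := norm_sub_norm_le y (-x)
      have n2 := norm_sub_norm_le y x
      rw [norm_neg, sub_neg_eq_add, add_comm y x] at n1
      rw [norm_sub_rev] at n2
      simp only [sd]
      rw [bmp_zero N ha (by linarith : a ≤ ‖x + y‖), bmp_zero N ha (by linarith : a ≤ ‖x - y‖)]
      ring
    rw [e1, integral_const_mul]
    congr 1
    refine setIntegral_eq_integral_of_forall_compl_eq_zero fun x hx => bmp_zero N ha ?_
    simp at hx; linarith
  simp only [Function.mem_support]
  rw [e]
  have := bmp_int_pos N ha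
  positivity


theorem hh_radial (N : ℕ) (s a : ℝ) {x x' : EN N} (h : ‖x‖ = ‖x'‖) : hh N s a x = hh N s a x' := by
  have hR := Submodule.reflection_sub h.symm
  set R := (Submodule.span ℝ {x' - x})ᗮ.reflection with hRdef
  unfold hh Lsym
  congr 1
  rw [← (R.measurePreserving).integral_comp R.toHomeomorph.measurableEmbedding]
  congr 1
  ext y
  rw [R.norm_map]
  congr 1
  unfold sd bmp
  rw [← hR, ← map_add, ← map_sub]
  simp only [R.norm_map]

theorem hh_bdd (N : ℕ) (hN : 2 ≤ N) (s : ℝ) (hs : s ∈ Ioo (0:ℝ) 1) {a : ℝ} (ha : 0 < a) :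
    ∃ C : ℝ, 0 < C ∧ (∀ x : EN N, |hh N s a x| ≤ C) ∧
      ∀ x : EN N, x ≠ 0 → |hh N s a x| ≤ C * ‖x‖ ^ (-((N:ℝ) + 2*s)) := by
  obtain ⟨B, hB0, -, hB⟩ := sd_bound (bmp N a) (bmp_contDiff N a) (bmp_compact N ha)
  set p : ℝ := (N:ℝ) + 2*s with hp
  have hp0 : 0 < p := by have := hs.1; positivity
  have hC := CNs_pos N s hs
  set C1 : ℝ := CNs N s / 2 * ∫ y : EN N, B * (min (‖y‖ ^ 2) 1 / ‖y‖ ^ p) with hC1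
  have hC10 : 0 ≤ C1 := mul_nonneg (by positivity) (integral_nonneg fun y => by positivity)
  have b1 : ∀ x : EN N, |hh N s a x| ≤ C1 := by
    intro x
    unfold hh Lsym
    rw [abs_mul, abs_of_pos (by positivity : 0 < CNs N s / 2)]
    refine mul_le_mul_of_nonneg_left ?_ (by positivity)
    rw [← Real.norm_eq_abs]
    refine norm_integral_le_of_norm_le ((int_min N hN s hs).const_mul B) (Eventually.of_forall fun y => ?_)
    rw [norm_div, Real.norm_eq_abs, Real.norm_of_nonneg (by positivity : 0 ≤ ‖y‖ ^ p),
    ← mul_div_assoc]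
    gcongr
    exact hB x y
  have hI := bmp_int_pos N ha
  have h := bmp_integrable N ha
  set C2 : ℝ := CNs N s / 2 * (2 ^ p * (2 * ∫ x, bmp N a x)) with hC2
  have hC20 : 0 < C2 := by positivity
  have b2 : ∀ x : EN N, 2 * a ≤ ‖x‖ → |hh N s a x| ≤ C2 * ‖x‖ ^ (-p) := by
    intro x hx
    have hx0 : 0 < ‖x‖ := by linarith
    unfold hh Lsym
    rw [abs_mul, abs_of_pos (by positivity : 0 < CNs N s / 2), hC2, mul_assoc]
    refine mul_le_mul_of_nonneg_left ?_ (by positivity)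
    have hi : Integrable (fun y => 2 ^ p * ‖x‖ ^ (-p) * (bmp N a (x + y) + bmp N a (x - y))) :=
      ((h.comp_add_left x).add (h.comp_sub_left x)).const_mul _
    have hbd : ∀ y : EN N, ‖sd (bmp N a) x y / ‖y‖ ^ p‖ ≤
        2 ^ p * ‖x‖ ^ (-p) * (bmp N a (x + y) + bmp N a (x - y)) := by
      intro y
      have n1 := bmp_nonneg N a (x+y)
      have n2 := bmp_nonneg N a (x-y)
      by_cases hy : ‖x‖ / 2 ≤ ‖y‖
      · rw [norm_div, Real.norm_of_nonneg (by positivity : 0 ≤ ‖y‖ ^ p), sd,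
          bmp_zero N ha (by linarith : a ≤ ‖x‖), div_eq_mul_inv, mul_comm]
        have e : 2 ^ p * ‖x‖ ^ (-p) = ((‖x‖ / 2) ^ p)⁻¹ := by
          rw [Real.div_rpow hx0.le (by norm_num), Real.rpow_neg hx0.le]; field_simp
        rw [e]
        gcongr
        rw [Real.norm_eq_abs, abs_le]
        constructor <;> linarith
      · push Not at hy
        have m1 := norm_sub_norm_le x (-y)
        have m2 := norm_sub_norm_le x y
        rw [norm_neg, sub_neg_eq_add] at m1
        rw [sd, bmp_zero N ha (by linarith : a ≤ ‖x‖), bmp_zero N ha (by linarith : a ≤ ‖x + y‖),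
          bmp_zero N ha (by linarith : a ≤ ‖x - y‖)]
        simp
    rw [← Real.norm_eq_abs]
    refine (norm_integral_le_of_norm_le hi (Eventually.of_forall hbd)).trans (le_of_eq ?_)
    rw [integral_const_mul, integral_add (h.comp_add_left x) (h.comp_sub_left x),
      integral_add_left_eq_self, integral_sub_left_eq_self]
    ring
  clear_value C1 C2
  refine ⟨C1 + C2 + C1 * (2 * a) ^ p, by positivity, fun x => ?_, fun x hx => ?_⟩
  · refine (b1 x).trans ?_
    have : 0 ≤ C1 * (2 * a) ^ p := by positivity
    linarith
  · have hx0 : 0 < ‖x‖ := norm_pos_iff.2 hx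
    have hxp : 0 < ‖x‖ ^ (-p) := by positivity
    rcases le_total (2 * a) ‖x‖ with hxa | hxa
    · refine (b2 x hxa).trans ?_
      have : 0 ≤ C1 * (2 * a) ^ p := by positivity
      exact mul_le_mul_of_nonneg_right (by linarith) hxp.le
    · refine (b1 x).trans ?_
      have : 1 ≤ (2 * a) ^ p * ‖x‖ ^ (-p) := by
        rw [Real.rpow_neg hx0.le, ← div_eq_mul_inv, le_div_iff₀ (by positivity), one_mul]
        gcongr
      have h2 : 0 ≤ C2 * ‖x‖ ^ (-p) := by positivity
      have h3 : 0 ≤ C1 * ‖x‖ ^ (-p) := by positivity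
      nlinarith

theorem hh_profile (N : ℕ) (hN : 2 ≤ N) (s : ℝ) (hs : s ∈ Ioo (0:ℝ) 1) {a : ℝ} (ha : 0 < a) :
    ∃ H : ℝ → ℝ, (∀ x : EN N, hh N s a x = H ‖x‖) ∧
      (∀ c d : ℝ, IntervalIntegrable (fun τ => τ ^ (N - 1) * H τ) volume c d) ∧
      ∀ t, 0 ≤ t → mm N s a t = omegaN N * ∫ τ in (0:ℝ)..t, τ ^ (N - 1) * H τ := by
  have := EN_nontrivial N hN
  obtain ⟨e, he⟩ := exists_norm_eq (EN N) (zero_le_one)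
  obtain ⟨C, hC0, hC, -⟩ := hh_bdd N hN s hs ha
  set H : ℝ → ℝ := fun t => hh N s a (t • e) with hH
  have hHm : Measurable H := (hh_meas N s a).comp (by fun_prop)
  have hrad : ∀ x : EN N, hh N s a x = H ‖x‖ := fun x =>
    hh_radial N s a (by simp [norm_smul, he])
  refine ⟨H, hrad, fun c d => ?_, fun t ht => ?_⟩
  · refine IntervalIntegrable.mono_fun (f := fun τ : ℝ => C * τ ^ (N - 1))
      (Continuous.intervalIntegrable (by fun_prop) _ _) ?_ ?_
    · exact ((by fun_prop : Measurable fun τ : ℝ => τ ^ (N-1)).mul hHm).aestronglyMeasurable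
    · refine Eventually.of_forall fun τ => ?_
      simp only [norm_mul, Real.norm_of_nonneg hC0.le]
      rw [mul_comm]
      gcongr
      exact hC _
  · unfold mm
    rw [← integral_indicator measurableSet_ball]
    have e1 : (ball (0:EN N) t).indicator (fun x => hh N s a x) =
        fun x : EN N => (Iio t).indicator H ‖x‖ := by
      ext x
      by_cases hx : ‖x‖ < t
      · simp [hx, hrad x]
      · simp [hx]
    rw [e1, integral_fun_norm_addHaar (μ := volume) (f := (Iio t).indicator H)]
    have e2 : ∫ (y : ℝ) in Ioi 0, y ^ (Module.finrank ℝ (EN N) - 1) • (Iio t).indicator H y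
      = ∫ y in (0:ℝ)..t, y ^ (N - 1) * H y := by
      rw [intervalIntegral.integral_of_le ht, integral_Ioc_eq_integral_Ioo,
        ← integral_indicator measurableSet_Ioi, ← integral_indicator measurableSet_Ioo]
      congr 1
      ext y
      simp only [finrank_euclideanSpace, Fintype.card_fin, smul_eq_mul, indicator, mem_Ioi, mem_Ioo, mem_Iio]
      by_cases h1 : 0 < y <;> by_cases h2 : y < t <;> simp [h1, h2]
    rw [e2]
    simp only [finrank_euclideanSpace, Fintype.card_fin, nsmul_eq_mul, smul_eq_mul, omegaN, Measure.real]
    ring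

/-- approximate identity kernel -/
def kk (N : ℕ) (s a : ℝ) (x : EN N) : ℝ := mm N s a ‖x‖ / (omegaN N * ‖x‖ ^ N)

theorem kk_nonneg (N : ℕ) (hN : 2 ≤ N) (s : ℝ) (hs : s ∈ Ioo (0:ℝ) 1) {a : ℝ} (ha : 0 < a) (x : EN N) :
    0 ≤ kk N s a x := by
  have := omegaN_pos N hN
  exact div_nonneg (mm_nonneg N hN s hs ha _) (by positivity)

theorem kk_meas (N : ℕ) (hN : 2 ≤ N) (s : ℝ) (hs : s ∈ Ioo (0:ℝ) 1) {a : ℝ} (ha : 0 < a) :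
    Measurable (kk N s a) := by
  obtain ⟨H, -, hi, hm⟩ := hh_profile N hN s hs ha
  have : kk N s a = fun x => (omegaN N * ∫ τ in (0:ℝ)..‖x‖, τ ^ (N - 1) * H τ) / (omegaN N * ‖x‖ ^ N) := by
    ext x; rw [kk, hm _ (norm_nonneg _)]
  rw [this]
  have hc := intervalIntegral.continuous_primitive hi 0
  have h2 := (hc.comp (continuous_norm (E := EN N))).measurable
  exact (h2.const_mul _).div (by fun_prop)

theorem kk_identity (N : ℕ) (hN : 2 ≤ N) (s : ℝ) (hs : s ∈ Ioo (0:ℝ) 1) {a : ℝ} (ha : 0 < a)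
    {x : EN N} (hx : x ≠ 0) {n : ℝ} (hn : 1 ≤ n) :
    ∫ μ in (1:ℝ)..n, μ ^ (N - 1) * hh N s a (μ • x) = n ^ N * kk N s a (n • x) - kk N s a x := by
  obtain ⟨H, hH, hi, hm⟩ := hh_profile N hN s hs ha
  have hx0 : 0 < ‖x‖ := norm_pos_iff.2 hx
  have hw := omegaN_pos N hN
  have e1 : ∫ μ in (1:ℝ)..n, μ ^ (N - 1) * hh N s a (μ • x) =
      ‖x‖⁻¹ ^ (N-1) * ∫ μ in (1:ℝ)..n, (fun τ => τ ^ (N-1) * H τ) (μ * ‖x‖) := by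
    rw [← intervalIntegral.integral_const_mul]
    refine intervalIntegral.integral_congr fun μ hμ => ?_
    rw [uIcc_of_le hn] at hμ
    have hμ0 : 0 ≤ μ := by linarith [hμ.1]
    simp only [hH, norm_smul, Real.norm_of_nonneg hμ0]
    rw [mul_pow, inv_pow]
    field_simp
  rw [e1, intervalIntegral.integral_comp_mul_right (fun τ => τ ^ (N-1) * H τ) hx0.ne', one_mul,
    ← intervalIntegral.integral_interval_sub_left (hi 0 _) (hi 0 _)]
  rw [kk, kk, norm_smul, Real.norm_of_nonneg (by linarith : 0 ≤ n), hm _ (by positivity), hm _ (by positivity)]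
  have hpow : ‖x‖ ^ N = ‖x‖ ^ (N-1) * ‖x‖ := by
    rw [← pow_succ]; congr 1; omega
  rw [mul_pow, hpow, smul_eq_mul, inv_pow]
  have : n ≠ 0 := by linarith
  field_simp

theorem kk_bound (N : ℕ) (hN : 2 ≤ N) (s : ℝ) (hs : s ∈ Ioo (0:ℝ) 1) {a : ℝ} (ha : 0 < a) :
    ∃ C : ℝ, 0 < C ∧ (∀ x : EN N, kk N s a x ≤ C) ∧
      (∀ x : EN N, x ≠ 0 → kk N s a x ≤ C * ‖x‖ ^ (-((N:ℝ) + 2*s))) ∧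
      ∀ x : EN N, kk N s a x ≤ C * (1 / (1 + ‖x‖ ^ ((N:ℝ) + 2*s))) := by
  obtain ⟨C, hC0, hC1, hC2⟩ := hh_bdd N hN s hs ha
  have hw := omegaN_pos N hN
  have hs0 := hs.1
  have hN0 : N ≠ 0 := by omega
  have hnt := EN_nontrivial N hN
  set V : ℝ := volume.real (ball (0:EN N) 1) with hV
  have hV0 : 0 ≤ V := measureReal_nonneg
  have b1 : ∀ x : EN N, kk N s a x ≤ C * V / omegaN N := by
    intro x
    rcases eq_or_ne x 0 with rfl | hx
    · simp [kk, hN0]; positivity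
    have hx0 : 0 < ‖x‖ := norm_pos_iff.2 hx
    have h1 : mm N s a ‖x‖ ≤ C * (‖x‖ ^ N * V) := by
      refine (le_abs_self _).trans ?_
      have := norm_setIntegral_le_of_norm_le_const (μ := volume) (f := hh N s a) (s := ball (0:EN N) ‖x‖) (C := C)
        measure_ball_lt_top (fun y _ => hC1 y)
      refine this.trans (le_of_eq ?_)
      rw [Measure.real, Measure.addHaar_ball _ _ hx0.le, ENNReal.toReal_mul,
        ENNReal.toReal_ofReal (by positivity)]
      simp [hV, Measure.real]
    rw [kk, div_le_div_iff₀ (by positivity) hw]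
    nlinarith
  have b2 : ∀ x : EN N, x ≠ 0 → kk N s a x ≤ (C * (2 ^ (2*s) / (2*s))) * ‖x‖ ^ (-((N:ℝ) + 2*s)) := by
    intro x hx
    have hx0 : 0 < ‖x‖ := norm_pos_iff.2 hx
    have h1 : mm N s a ‖x‖ ≤ C * (omegaN N * ((‖x‖/2) ^ (-(2*s)) / (2*s))) := by
      have e0 : mm N s a ‖x‖ = - ∫ y in (ball (0:EN N) ‖x‖)ᶜ, hh N s a y := by
        have := integral_add_compl (measurableSet_ball (x := (0:EN N)) (ε := ‖x‖)) (hh_integrable N hN s hs ha)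
        rw [hh_int_zero N hN s hs ha] at this
        unfold mm; linarith
      rw [e0]
      refine (neg_le_abs _).trans ?_
      have hfar := int_far N hN ((N:ℝ) + 2*s) (‖x‖/2) (by positivity) (by linarith)
      have hsub : (ball (0:EN N) ‖x‖)ᶜ ⊆ (closedBall (0:EN N) (‖x‖/2))ᶜ := by
        intro y hy
        simp at hy ⊢
        linarith
      have h2 : |∫ y in (ball (0:EN N) ‖x‖)ᶜ, hh N s a y| ≤
          ∫ y in (ball (0:EN N) ‖x‖)ᶜ, C * ‖y‖ ^ (-((N:ℝ) + 2*s)) := by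
        rw [← Real.norm_eq_abs]
        refine norm_integral_le_of_norm_le ((hfar.mono_set hsub).const_mul C) ?_
        refine (ae_restrict_mem measurableSet_ball.compl).mono fun y hy => hC2 y ?_
        rintro rfl
        simp at hy; exact hx hy
      refine h2.trans ?_
      rw [integral_const_mul]
      refine mul_le_mul_of_nonneg_left ?_ hC0.le
      refine (setIntegral_mono_set hfar (Eventually.of_forall fun y => by simp only [Pi.zero_apply]; positivity)
        (LE.le.eventuallyLE hsub)).trans (le_of_eq ?_)
      rw [integral_far N hN _ _ (by positivity) (by linarith)]
      congr 3 <;> ring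
    have e2 : (‖x‖/2) ^ (-(2*s)) = 2 ^ (2*s) * ‖x‖ ^ (-(2*s)) := by
      rw [Real.div_rpow hx0.le (by norm_num), Real.rpow_neg (by norm_num : (0:ℝ) ≤ 2)]; field_simp
    have e3 : ‖x‖ ^ (-((N:ℝ) + 2*s)) = ‖x‖ ^ (-(2*s)) / ‖x‖ ^ N := by
      rw [← Real.rpow_natCast, ← Real.rpow_sub hx0]; congr 1; ring
    rw [kk, div_le_iff₀ (by positivity), e3]
    refine h1.trans (le_of_eq ?_)
    rw [e2]
    field_simp
  have hp1 : 0 ≤ C * V / omegaN N := by positivity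
  have hp2 : 0 < C * (2 ^ (2*s) / (2*s)) := by positivity
  refine ⟨2 * (C * V / omegaN N + C * (2 ^ (2*s) / (2*s))), by positivity, fun x => ?_, fun x hx => ?_, fun x => ?_⟩
  · linarith [b1 x]
  · refine (b2 x hx).trans ?_
    exact mul_le_mul_of_nonneg_right (by linarith) (by positivity)
  · rw [mul_one_div, le_div_iff₀ (by positivity)]
    have h0 := kk_nonneg N hN s hs ha x
    have k1 := b1 x
    rcases eq_or_ne x 0 with rfl | hx
    · rw [norm_zero, Real.zero_rpow (by positivity)]; linarith
    have hx0 : 0 < ‖x‖ := norm_pos_iff.2 hx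
    have k2 := b2 x hx
    rw [Real.rpow_neg hx0.le, ← div_eq_mul_inv, le_div_iff₀ (by positivity)] at k2
    linarith

theorem kk_integrable (N : ℕ) (hN : 2 ≤ N) (s : ℝ) (hs : s ∈ Ioo (0:ℝ) 1) {a : ℝ} (ha : 0 < a) :
    Integrable (kk N s a) := by
  obtain ⟨C, hC0, -, -, hC⟩ := kk_bound N hN s hs ha
  refine ((int_weight N hN s hs).const_mul C).mono' (kk_meas N hN s hs ha).aestronglyMeasurable
    (Eventually.of_forall fun x => ?_)
  rw [Real.norm_of_nonneg (kk_nonneg N hN s hs ha x)]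
  exact hC x

theorem kk_int_pos (N : ℕ) (hN : 2 ≤ N) (s : ℝ) (hs : s ∈ Ioo (0:ℝ) 1) {a : ℝ} (ha : 0 < a) :
    0 < ∫ x, kk N s a x := by
  have hnt := EN_nontrivial N hN
  rw [integral_pos_iff_support_of_nonneg (kk_nonneg N hN s hs ha) (kk_integrable N hN s hs ha)]
  obtain ⟨w, hw⟩ := exists_norm_eq (EN N) (by linarith : 0 ≤ a + 1)
  refine (measure_ball_pos volume w (one_pos)).trans_le (measure_mono ?_)
  intro y hy
  have hy1 : a < ‖y‖ := by
    have h1 : ‖y - w‖ < 1 := by simpa [dist_eq_norm] using hy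
    have h2 := norm_sub_norm_le w y
    rw [norm_sub_rev] at h2
    linarith
  have h1 := mm_pos N hN s hs ha hy1.le
  have h2 := omegaN_pos N hN
  have h3 : 0 < ‖y‖ := ha.trans hy1
  simp only [Function.mem_support, kk]
  positivity


/-- truncated Riesz-type test function -/
def PP (N : ℕ) (s a n : ℝ) (x : EN N) : ℝ :=
  ∫ μ in (1:ℝ)..n, μ ^ ((N:ℝ) - 2*s - 1) * bmp N a (μ • x)

theorem PP_contDiff (N : ℕ) (s a : ℝ) {n : ℝ} (hn : 1 ≤ n) : ContDiff ℝ (⊤ : ℕ∞) (PP N s a n) := by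
  let χ : ContDiffBump (0:ℝ) := ⟨n, n+1, by linarith, by linarith⟩
  set f : ℝ → ℝ := (Ioc 1 n).indicator (fun μ => μ ^ ((N:ℝ) - 2*s - 1)) with hf
  set g : EN N → ℝ → ℝ := fun x u => χ (-u) * bmp N a ((-u) • x) with hg
  have hfi : IntegrableOn (fun μ : ℝ => μ ^ ((N:ℝ) - 2*s - 1)) (Ioc 1 n) := by
    refine IntegrableOn.mono_set ?_ Ioc_subset_Icc_self
    refine ContinuousOn.integrableOn_Icc ?_
    intro μ hμ
    exact (Real.continuousAt_rpow_const _ _ (Or.inl (by linarith [hμ.1]))).continuousWithinAt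
  have hfl : LocallyIntegrable f := (hfi.integrable_indicator measurableSet_Ioc).locallyIntegrable
  have key := contDiffOn_convolution_right_with_param_comp (𝕜 := ℝ) (μ := volume) (n := ⊤)
    (ContinuousLinearMap.mul ℝ ℝ) (s := (univ : Set (EN N))) (v := fun _ => (0:ℝ)) contDiffOn_const
    (f := f) (g := g) (k := closedBall (0:ℝ) (n+1)) isOpen_univ (isCompact_closedBall _ _) ?_ hfl ?_
  · rw [contDiffOn_univ] at key
    convert key using 1
    ext x
    rw [PP, intervalIntegral.integral_of_le hn, ← integral_indicator measurableSet_Ioc]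
    simp only [convolution, ContinuousLinearMap.mul_apply']
    congr 1
    ext μ
    by_cases hμ : μ ∈ Ioc 1 n
    · have : χ μ = 1 := χ.one_of_mem_closedBall (by
        simp only [mem_closedBall, dist_zero_right, Real.norm_eq_abs, abs_of_pos (by linarith [hμ.1] : 0 < μ)]
        exact hμ.2)
      simp only [hf, hg, indicator_of_mem hμ, zero_sub, neg_neg, this, one_mul]
    · simp only [hf, indicator_of_notMem hμ, zero_mul]
  · intro x u _ hu
    have : χ (-u) = 0 := χ.zero_of_le_dist (by
      simp only [mem_closedBall, dist_zero_right, norm_neg] at hu ⊢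
      exact (not_le.1 hu).le)
    simp [hg, this]
  · have h1 : ContDiff ℝ (⊤:ℕ∞) (fun q : EN N × ℝ => χ (-q.2) * bmp N a ((-q.2) • q.1)) := by
      have h2 : ContDiff ℝ (⊤:ℕ∞) (fun q : EN N × ℝ => χ (-q.2)) := χ.contDiff.comp (by fun_prop)
      exact h2.mul ((bmp_contDiff N a).comp (by fun_prop))
    exact h1.contDiffOn

theorem PP_zero (N : ℕ) (s : ℝ) {a : ℝ} (ha : 0 < a) {n : ℝ} (hn : 1 ≤ n) {x : EN N} (hx : a ≤ ‖x‖) :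
    PP N s a n x = 0 := by
  unfold PP
  rw [intervalIntegral.integral_congr (g := fun _ => 0)]
  · simp
  · intro μ hμ
    rw [uIcc_of_le hn] at hμ
    simp only
    rw [bmp_zero N ha, mul_zero]
    rw [norm_smul, Real.norm_of_nonneg (by linarith [hμ.1])]
    nlinarith [hμ.1]

theorem PP_tsupport (N : ℕ) (s : ℝ) {a : ℝ} (ha : 0 < a) {n : ℝ} (hn : 1 ≤ n) :
    tsupport (PP N s a n) ⊆ closedBall 0 a := by
  refine closure_minimal ?_ isClosed_closedBall
  intro x hx
  by_contra h
  simp only [mem_closedBall, dist_zero_right, not_le] at h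
  exact hx (PP_zero N s ha hn h.le)

theorem PP_compact (N : ℕ) (s : ℝ) {a : ℝ} (ha : 0 < a) {n : ℝ} (hn : 1 ≤ n) :
    HasCompactSupport (PP N s a n) :=
  (isCompact_closedBall (0:EN N) a).of_isClosed_subset (isClosed_tsupport _) (PP_tsupport N s ha hn)

theorem PP_nonneg (N : ℕ) (s a : ℝ) {n : ℝ} (hn : 1 ≤ n) (x : EN N) : 0 ≤ PP N s a n x := by
  refine intervalIntegral.integral_nonneg hn fun μ hμ => ?_
  have : 0 ≤ μ := by linarith [hμ.1]
  have := bmp_nonneg N a (μ • x)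
  positivity

theorem PP_le (N : ℕ) (hN : 2 ≤ N) (s : ℝ) (hs : s ∈ Ioo (0:ℝ) 1) {a : ℝ} (ha : 0 < a) {n : ℝ} (hn : 1 ≤ n)
    {x : EN N} (hx : x ≠ 0) :
    PP N s a n x ≤ (a ^ ((N:ℝ) - 2*s) / ((N:ℝ) - 2*s)) * ‖x‖ ^ (-((N:ℝ) - 2*s)) := by
  have hN' : (2:ℝ) ≤ N := by exact_mod_cast hN
  have hα : 0 < (N:ℝ) - 2*s := by linarith [hs.2]
  set α := (N:ℝ) - 2*s
  have hx0 : 0 < ‖x‖ := norm_pos_iff.2 hx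
  have hT : 0 < a / ‖x‖ := by positivity
  have hIntg : IntegrableOn (fun μ : ℝ => μ ^ (α - 1)) (Ioc 0 (a/‖x‖)) := by
    have := intervalIntegral.intervalIntegrable_rpow' (a := 0) (b := a/‖x‖) (r := α - 1) (by linarith)
    exact (intervalIntegrable_iff_integrableOn_Ioc_of_le hT.le).1 this
  have hIntgB := hIntg.integrable_indicator measurableSet_Ioc
  have h1 : PP N s a n x ≤ ∫ μ : ℝ, (Ioc 0 (a/‖x‖)).indicator (fun μ : ℝ => μ ^ (α - 1)) μ := by
    unfold PP
    rw [intervalIntegral.integral_of_le hn, ← integral_indicator measurableSet_Ioc]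
    refine integral_mono_of_nonneg (Eventually.of_forall fun μ => ?_) hIntgB (Eventually.of_forall fun μ => ?_)
    · refine indicator_nonneg (fun μ hμ => ?_) μ
      have : 0 ≤ μ := by linarith [hμ.1]
      have := bmp_nonneg N a (μ • x)
      positivity
    · by_cases hμ : μ ∈ Ioc 1 n
      · have hμ0 : 0 < μ := by linarith [hμ.1]
        simp only [indicator_of_mem hμ]
        by_cases hμ2 : μ ≤ a / ‖x‖
        · have hm : μ ∈ Ioc 0 (a/‖x‖) := ⟨hμ0, hμ2⟩
          rw [indicator_of_mem hm]
          exact mul_le_of_le_one_right (by positivity) (bmp_le_one _ _ _)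
        · rw [bmp_zero N ha, mul_zero]
          · exact indicator_nonneg (fun μ hμ => by have := hμ.1; positivity) μ
          · rw [norm_smul, Real.norm_of_nonneg hμ0.le]
            push Not at hμ2
            rw [div_lt_iff₀ hx0] at hμ2
            exact hμ2.le
      · simp only [indicator_of_notMem hμ]
        exact indicator_nonneg (fun μ hμ => by have := hμ.1; positivity) μ
  refine h1.trans (le_of_eq ?_)
  rw [integral_indicator measurableSet_Ioc, ← intervalIntegral.integral_of_le hT.le,
    integral_rpow (Or.inl (by linarith)), sub_add_cancel, Real.zero_rpow hα.ne', sub_zero,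
    Real.div_rpow ha.le hx0.le, Real.rpow_neg hx0.le]
  field_simp

theorem PP_Lsym (N : ℕ) (hN : 2 ≤ N) (s : ℝ) (hs : s ∈ Ioo (0:ℝ) 1) {a : ℝ} (ha : 0 < a) {n : ℝ} (hn : 1 ≤ n)
    {x : EN N} (hx : x ≠ 0) :
    Lsym N s (PP N s a n) x = n ^ N * kk N s a (n • x) - kk N s a x := by
  rw [← kk_identity N hN s hs ha hx hn]
  obtain ⟨B, hB0, hφB, hB⟩ := sd_bound (bmp N a) (bmp_contDiff N a) (bmp_compact N ha)
  have hc : Continuous (bmp N a) := (bmp_contDiff N a).continuous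
  have hs0 := hs.1
  have hii : ∀ z : EN N, IntervalIntegrable (fun μ : ℝ => μ ^ ((N:ℝ) - 2*s - 1) * bmp N a (μ • z)) volume 1 n := by
    intro z
    refine ContinuousOn.intervalIntegrable ?_
    rw [uIcc_of_le hn]
    refine ContinuousOn.mul ?_ (by fun_prop)
    intro μ hμ
    exact (Real.continuousAt_rpow_const _ _ (Or.inl (by linarith [hμ.1]))).continuousWithinAt
  have e1 : ∀ y, sd (PP N s a n) x y = ∫ μ in (1:ℝ)..n, μ ^ ((N:ℝ) - 2*s - 1) * sd (bmp N a) (μ • x) (μ • y) := by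
    intro y
    unfold sd PP
    rw [← intervalIntegral.integral_const_mul, ← intervalIntegral.integral_sub ((hii _).const_mul _) (hii _),
      ← intervalIntegral.integral_sub (((hii _).const_mul _).sub (hii _)) (hii _)]
    refine intervalIntegral.integral_congr fun μ _ => ?_
    simp only [smul_add, smul_sub]
    ring
  set p : ℝ := (N:ℝ) + 2*s with hp
  have hp0 : 0 < p := by positivity
  have hcsd : Continuous fun q : ℝ × EN N => sd (bmp N a) (q.1 • x) (q.1 • q.2) := by
    unfold sd; fun_prop
  have hprod : Integrable (Function.uncurry fun (μ : ℝ) (y : EN N) =>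
      μ ^ ((N:ℝ) - 2*s - 1) * sd (bmp N a) (μ • x) (μ • y) / ‖y‖ ^ p)
      ((volume.restrict (Ioc 1 n)).prod volume) := by
    have h0 : Integrable (fun _ : ℝ => n ^ (N:ℝ) * (B * n ^ 2)) (volume.restrict (Ioc 1 n)) := integrable_const _
    refine (h0.mul_prod (int_min N hN s hs)).mono' ?_ ?_
    · have m1 : Measurable fun q : ℝ × EN N => q.1 ^ ((N:ℝ) - 2*s - 1) := by fun_prop
      have m2 : Measurable fun q : ℝ × EN N => ‖q.2‖ ^ p := by fun_prop
      exact ((m1.mul hcsd.measurable).div m2).aestronglyMeasurable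
    · have : (volume.restrict (Ioc 1 n)).prod (volume : Measure (EN N)) = (volume.prod volume).restrict (Ioc 1 n ×ˢ univ) := by
        rw [← Measure.prod_restrict, Measure.restrict_univ]
      rw [this]
      refine (ae_restrict_mem (measurableSet_Ioc.prod MeasurableSet.univ)).mono ?_
      rintro ⟨μ, y⟩ ⟨hμ, -⟩
      simp only at hμ
      have hμ0 : 0 < μ := by linarith [hμ.1]
      simp only [Function.uncurry, norm_div, norm_mul, Real.norm_of_nonneg (by positivity : 0 ≤ μ ^ ((N:ℝ) - 2*s - 1)),
        Real.norm_of_nonneg (by positivity : 0 ≤ ‖y‖ ^ p)]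
      rw [← mul_div_assoc, mul_assoc (n ^ (N:ℝ))]
      refine div_le_div_of_nonneg_right ?_ (by positivity)
      refine mul_le_mul ?_ ?_ (norm_nonneg _) (by positivity)
      · calc μ ^ ((N:ℝ) - 2*s - 1) ≤ μ ^ (N:ℝ) := Real.rpow_le_rpow_of_exponent_le hμ.1.le (by linarith)
          _ ≤ n ^ (N:ℝ) := Real.rpow_le_rpow hμ0.le hμ.2 (by positivity)
      · refine (hB _ _).trans ?_
        rw [mul_assoc]
        refine mul_le_mul_of_nonneg_left ?_ hB0
        rw [norm_smul, Real.norm_of_nonneg hμ0.le, mul_pow]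
        have h2 : μ ^ 2 ≤ n ^ 2 := by gcongr; exact hμ.2
        have h3 : 1 ≤ n ^ 2 := by nlinarith
        rcases le_total (‖y‖^2) 1 with h | h
        · rw [min_eq_left h]
          exact (min_le_left _ _).trans (by gcongr)
        · rw [min_eq_right h]
          exact (min_le_right _ _).trans (by linarith)
  unfold Lsym
  have e2 : (fun y => sd (PP N s a n) x y / ‖y‖ ^ p) = fun y => ∫ μ in Ioc 1 n,
      μ ^ ((N:ℝ) - 2*s - 1) * sd (bmp N a) (μ • x) (μ • y) / ‖y‖ ^ p := by
    ext y
    rw [e1, intervalIntegral.integral_of_le hn, integral_div]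
  rw [e2, ← integral_integral_swap hprod, intervalIntegral.integral_of_le hn, ← integral_const_mul]
  refine setIntegral_congr_fun measurableSet_Ioc fun μ hμ => ?_
  have hμ0 : 0 < μ := by linarith [hμ.1]
  simp only [hh, Lsym]
  have e3 : (fun y : EN N => μ ^ ((N:ℝ) - 2*s - 1) * sd (bmp N a) (μ • x) (μ • y) / ‖y‖ ^ p) =
      fun y => (μ ^ ((N:ℝ) - 2*s - 1) * μ ^ p) * (fun z => sd (bmp N a) (μ • x) z / ‖z‖ ^ p) (μ • y) := by
    ext y
    simp only [norm_smul, Real.norm_of_nonneg hμ0.le]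
    rw [Real.mul_rpow hμ0.le (norm_nonneg _)]
    field_simp
  rw [e3, integral_const_mul, Measure.integral_comp_smul volume (fun z => sd (bmp N a) (μ • x) z / ‖z‖ ^ p) μ]
  simp only [finrank_euclideanSpace, Fintype.card_fin, smul_eq_mul]
  rw [abs_of_pos (by positivity)]
  have e4 : μ ^ ((N:ℝ) - 2*s - 1) * μ ^ p * (μ ^ N)⁻¹ = μ ^ (N-1) := by
    rw [← Real.rpow_natCast, ← Real.rpow_natCast, ← Real.rpow_neg hμ0.le, ← Real.rpow_add hμ0, ← Real.rpow_add hμ0,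
      Nat.cast_sub (by omega)]
    congr 1
    rw [hp]; push_cast; ring
  rw [← e4]
  ring

open scoped ENNReal

theorem weight_shift (N : ℕ) {p : ℝ} (hp : 0 < p) {X : ℝ} (hX : 0 ≤ X) :
    ∃ W : ℝ, 0 < W ∧ ∀ x y : EN N, ‖x‖ ≤ X → 1 / (1 + ‖y - x‖ ^ p) ≤ W * (1 / (1 + ‖y‖ ^ p)) := by
  refine ⟨1 + 2 ^ p * X ^ p + 2 ^ p, by positivity, fun x y hx => ?_⟩
  rw [mul_one_div, div_le_div_iff₀ (by positivity) (by positivity), one_mul]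
  have h1 : ‖y‖ ≤ 2 * max ‖y - x‖ X := by
    have h2 : ‖y‖ ≤ ‖y - x‖ + ‖x‖ := by simpa using norm_add_le (y - x) x
    have := le_max_left ‖y - x‖ X
    have := le_max_right ‖y - x‖ X
    linarith
  have h3 : ‖y‖ ^ p ≤ 2 ^ p * (‖y - x‖ ^ p + X ^ p) := by
    calc ‖y‖ ^ p ≤ (2 * max ‖y - x‖ X) ^ p := Real.rpow_le_rpow (norm_nonneg _) h1 hp.le
      _ = 2 ^ p * (max ‖y - x‖ X) ^ p := Real.mul_rpow (by norm_num) (le_max_of_le_right hX)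
      _ ≤ _ := by
        refine mul_le_mul_of_nonneg_left ?_ (by positivity)
        have e1 : 0 ≤ ‖y - x‖ ^ p := by positivity
        have e2 : 0 ≤ X ^ p := by positivity
        rcases max_choice ‖y - x‖ X with h | h <;> rw [h] <;> linarith
  have e1 : 0 ≤ ‖y - x‖ ^ p := by positivity
  have e2 : 0 ≤ X ^ p := by positivity
  have e3 : 0 ≤ (2:ℝ) ^ p := by positivity
  nlinarith [mul_nonneg e3 e1, mul_nonneg e3 e2, mul_nonneg (mul_nonneg e3 e2) e1]

theorem u_meas {N : ℕ} {s : ℝ} {u : EN N → ℝ} (h : MemL1w N s u) : AEStronglyMeasurable u := by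
  have h1 := h.aestronglyMeasurable
  have h2 : Measurable fun x : EN N => 1 + ‖x‖ ^ ((N:ℝ) + 2*s) := by fun_prop
  refine (h1.mul h2.aestronglyMeasurable).congr (Eventually.of_forall fun x => ?_)
  have : 0 < 1 + ‖x‖ ^ ((N:ℝ) + 2*s) := by positivity
  simp only [Pi.mul_apply]
  field_simp

theorem u_abs_int {N : ℕ} {s : ℝ} {u : EN N → ℝ} (h : MemL1w N s u) :
    Integrable fun y => |u y| / (1 + ‖y‖ ^ ((N:ℝ) + 2*s)) := by
  refine h.abs.congr (Eventually.of_forall fun x => ?_)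
  simp only [abs_div]
  rw [abs_of_pos (by positivity : 0 < 1 + ‖x‖ ^ ((N:ℝ) + 2*s))]

theorem riesz_sup (N : ℕ) (hN : 2 ≤ N) (x0 : EN N) (r : ℝ) {δ : ℝ} (h0 : 0 ≤ δ) (hδ : δ < N) :
    ∃ D : ℝ, 0 ≤ D ∧ ∀ w : EN N, ∫⁻ y in ball x0 r, ENNReal.ofReal (‖w - y‖ ^ (-δ)) ≤ ENNReal.ofReal D := by
  have hi := int_near N hN δ 1 one_pos hδ
  set F : EN N → ℝ≥0∞ := (ball (0:EN N) 1).indicator (fun z => ENNReal.ofReal (‖z‖ ^ (-δ))) with hF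
  have hF1 : ∫⁻ z, F z ≠ ∞ := by
    rw [hF, lintegral_indicator measurableSet_ball]
    exact (hi.lintegral_lt_top).ne
  have hfin : volume (ball x0 r) + ∫⁻ z, F z ≠ ∞ := ENNReal.add_ne_top.2 ⟨measure_ball_lt_top.ne, hF1⟩
  refine ⟨(volume (ball x0 r) + ∫⁻ z, F z).toReal, ENNReal.toReal_nonneg, fun w => ?_⟩
  rw [ENNReal.ofReal_toReal hfin]
  calc ∫⁻ y in ball x0 r, ENNReal.ofReal (‖w - y‖ ^ (-δ)) ≤ ∫⁻ y in ball x0 r, (1 + F (w - y)) := by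
        refine lintegral_mono fun y => ?_
        by_cases h : ‖w - y‖ < 1
        · have : w - y ∈ ball (0:EN N) 1 := by simpa using h
          simp only [hF, indicator_of_mem this]
          exact le_add_self
        · refine le_add_right ?_
          rw [← ENNReal.ofReal_one]
          refine ENNReal.ofReal_le_ofReal ?_
          exact Real.rpow_le_one_of_one_le_of_nonpos (not_lt.1 h) (by linarith)
    _ = volume (ball x0 r) + ∫⁻ y in ball x0 r, F (w - y) := by
        rw [lintegral_add_left measurable_const]; simp
    _ ≤ _ := by
        refine add_le_add le_rfl ?_
        refine (setLIntegral_le_lintegral _ _).trans (le_of_eq ?_)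
        exact lintegral_sub_left_eq_self F w

theorem kk_n_bound (N : ℕ) (hN : 2 ≤ N) (s : ℝ) (hs : s ∈ Ioo (0:ℝ) 1) {a : ℝ} (ha : 0 < a) {X : ℝ} (hX : 0 ≤ X) :
    ∃ W : ℝ, 0 < W ∧ ∀ n : ℝ, 1 ≤ n → ∀ x y : EN N, ‖x‖ ≤ X →
      kk N s a (n • (y - x)) ≤ W * (1 / (1 + ‖y‖ ^ ((N:ℝ) + 2*s))) := by
  obtain ⟨C, hC0, -, -, hC⟩ := kk_bound N hN s hs ha
  have hp : 0 < (N:ℝ) + 2*s := by have := hs.1; positivity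
  obtain ⟨W, hW0, hW⟩ := weight_shift N hp hX
  refine ⟨C * W, by positivity, fun n hn x y hx => ?_⟩
  refine (hC _).trans ?_
  rw [mul_assoc]
  refine mul_le_mul_of_nonneg_left (le_trans ?_ (hW x y hx)) hC0.le
  refine one_div_le_one_div_of_le (by positivity) ?_
  gcongr
  rw [norm_smul, Real.norm_of_nonneg (by linarith)]
  exact le_mul_of_one_le_left (norm_nonneg _) hn

theorem uK_integrable (N : ℕ) (hN : 2 ≤ N) (s : ℝ) (hs : s ∈ Ioo (0:ℝ) 1) {a : ℝ} (ha : 0 < a)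
    {u : EN N → ℝ} (hu : MemL1w N s u) {n : ℝ} (hn : 1 ≤ n) (x : EN N) :
    Integrable fun y => u y * kk N s a (n • (y - x)) := by
  obtain ⟨W, hW0, hW⟩ := kk_n_bound N hN s hs ha (norm_nonneg x)
  refine ((u_abs_int hu).const_mul W).mono' ?_ (Eventually.of_forall fun y => ?_)
  · exact (u_meas hu).mul ((kk_meas N hN s hs ha).comp (by fun_prop : Measurable fun y => n • (y - x))).aestronglyMeasurable
  · rw [norm_mul, Real.norm_eq_abs, Real.norm_of_nonneg (kk_nonneg N hN s hs ha _)]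
    refine (mul_le_mul_of_nonneg_left (hW n hn x y le_rfl) (abs_nonneg _)).trans (le_of_eq ?_)
    ring

/-- The weak formulation. -/
def WSol (N : ℕ) (s : ℝ) (x0 : EN N) (r : ℝ) (V f u : EN N → ℝ) : Prop :=
  ∀ φ : EN N → ℝ, ContDiff ℝ (⊤ : ℕ∞) φ → HasCompactSupport φ →
          tsupport φ ⊆ ball x0 r →
          ∀ g : EN N → ℝ, (∀ x, HasFracLap N s φ x (g x)) →
            (∫ x, u x * g x) + (∫ x in ball x0 r, V x * u x * φ x) =
              ∫ x in ball x0 r, f x * φ x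

/-- Total data. -/
def AA (N : ℕ) (s : ℝ) (u : EN N → ℝ) (Mf : ℝ) : ℝ := Mf + ∫ y : EN N, |u y| / (1 + ‖y‖ ^ ((N:ℝ) + 2*s))

/-- Riesz potential. -/
def QQ (N : ℕ) (x0 : EN N) (r : ℝ) (u : EN N → ℝ) (β : ℝ) (x : EN N) : ℝ≥0∞ :=
  ∫⁻ y in ball x0 r, ENNReal.ofReal (‖x - y‖ ^ (-β)) * ENNReal.ofReal |u y|

theorem bd_nonneg {N : ℕ} {x0 : EN N} {r : ℝ} (hr : 0 < r) {f : EN N → ℝ} {M : ℝ}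
    (h : ∀ᵐ x ∂(volume.restrict (ball x0 r)), |f x| ≤ M) : 0 ≤ M := by
  have : (ae (volume.restrict (ball x0 r))).NeBot := by
    rw [ae_neBot]
    intro h0
    rw [Measure.restrict_eq_zero] at h0
    exact (measure_ball_pos volume x0 hr).ne' h0
  obtain ⟨x, hx⟩ := h.exists
  exact (abs_nonneg _).trans hx

theorem base_pt (N : ℕ) (hN : 2 ≤ N) (s : ℝ) (hs : s ∈ Ioo (0:ℝ) 1)
    (x0 : EN N) {r R a: ℝ} (hr : 0 < r) (ha : 0 < a) (hRa : R + a ≤ r)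
    (V : EN N → ℝ) (MV : ℝ) (hV : ∀ᵐ x ∂(volume.restrict (ball x0 r)), |V x| ≤ MV) :
    ∃ C : ℝ, 0 < C ∧ ∀ f u : EN N → ℝ, ∀ Mf : ℝ, (∀ᵐ x ∂(volume.restrict (ball x0 r)), |f x| ≤ Mf) →
      MemL1w N s u → WSol N s x0 r V f u → ∀ x ∈ ball x0 R, ∀ n : ℝ, 1 ≤ n →
      ENNReal.ofReal |∫ y, u y * (n ^ N * kk N s a (n • (y - x)))| ≤
        ENNReal.ofReal (C * AA N s u Mf) + ENNReal.ofReal C * QQ N x0 r u ((N:ℝ) - 2*s) x := by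
  have hN' : (2:ℝ) ≤ N := by exact_mod_cast hN
  have hs0 := hs.1
  have hα : 0 < (N:ℝ) - 2*s := by linarith [hs.2]
  have hMV := bd_nonneg hr hV
  obtain ⟨D, hD0, hD⟩ := riesz_sup N hN x0 r hα.le (by linarith)
  obtain ⟨W, hW0, hW⟩ := kk_n_bound N hN s hs ha (X := ‖x0‖ + |R|) (by positivity)
  have hnt := EN_nontrivial N hN
  set C' : ℝ := a ^ ((N:ℝ) - 2*s) / ((N:ℝ) - 2*s) with hC'
  have hC'0 : 0 < C' := by positivity
  refine ⟨W + C' * D + MV * C', by positivity, fun f u Mf hf hu hw x hx n hn => ?_⟩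
  have hMf := bd_nonneg hr hf
  by_cases hQ : QQ N x0 r u ((N:ℝ) - 2*s) x = ∞
  · rw [hQ, ENNReal.mul_top]
    · simp
    · rw [Ne, ENNReal.ofReal_eq_zero, not_le]; positivity
  have hxX : ‖x‖ ≤ ‖x0‖ + |R| := by
    have h1 : ‖x - x0‖ < R := by simpa [dist_eq_norm] using hx
    have h2 : ‖x‖ ≤ ‖x - x0‖ + ‖x0‖ := by simpa using norm_add_le (x - x0) x0
    have := le_abs_self R
    linarith
  set φ : EN N → ℝ := fun y => PP N s a n (y - x) with hφ
  have c1 : ContDiff ℝ (⊤ : ℕ∞) φ := (PP_contDiff N s a hn).comp (by fun_prop)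
  have hts : tsupport φ ⊆ closedBall x a := by
    refine closure_minimal ?_ isClosed_closedBall
    intro y hy
    by_contra h
    simp only [mem_closedBall, dist_eq_norm, not_le] at h
    exact hy (PP_zero N s ha hn h.le)
  have c2 : HasCompactSupport φ :=
    (isCompact_closedBall x a).of_isClosed_subset (isClosed_tsupport _) hts
  have c3 : tsupport φ ⊆ ball x0 r := by
    refine hts.trans (closedBall_subset_ball' ?_)
    have : dist x x0 < R := hx
    linarith
  have key := hw φ c1 c2 c3 (Lsym N s φ) (hasFracLap_Lsym N hN s hs φ c1 c2)
  have hne : ∀ᵐ y : EN N, y ≠ x := by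
    rw [ae_iff]; simp
  have i1 := uK_integrable N hN s hs ha hu hn x
  have i2 := uK_integrable N hN s hs ha hu le_rfl x
  simp only [one_smul] at i2
  have e1 : ∫ y, u y * Lsym N s φ y = (∫ y, u y * (n ^ N * kk N s a (n • (y - x)))) - ∫ y, u y * kk N s a (y - x) := by
    rw [← integral_sub _ i2]
    · refine integral_congr_ae (hne.mono fun y hy => ?_)
      have h1 : Lsym N s φ y = Lsym N s (PP N s a n) (y - x) := by
        unfold Lsym
        congr 2
        ext z
        congr 1
        simp only [sd, hφ]
        congr 2
        · congr 2; abel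
        · abel
      simp only [h1]
      rw [PP_Lsym N hN s hs ha hn (sub_ne_zero.2 hy)]
      ring
    · refine (i1.const_mul (n ^ N)).congr (Eventually.of_forall fun y => ?_)
      simp only; ring
  set I0 := ∫ y : EN N, |u y| / (1 + ‖y‖ ^ ((N:ℝ) + 2*s)) with hI0
  have hI00 : 0 ≤ I0 := integral_nonneg fun y => by positivity
  have b1 : |∫ y, u y * kk N s a (y - x)| ≤ W * I0 := by
    rw [hI0, ← integral_const_mul, ← Real.norm_eq_abs]
    refine norm_integral_le_of_norm_le ((u_abs_int hu).const_mul W) (Eventually.of_forall fun y => ?_)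
    rw [norm_mul, Real.norm_eq_abs, Real.norm_of_nonneg (kk_nonneg N hN s hs ha _)]
    have := hW 1 le_rfl x y hxX
    rw [one_smul] at this
    refine (mul_le_mul_of_nonneg_left this (abs_nonneg _)).trans (le_of_eq ?_)
    ring
  have hφb : ∀ y, y ≠ x → |φ y| ≤ C' * ‖x - y‖ ^ (-((N:ℝ) - 2*s)) := by
    intro y hy
    rw [abs_of_nonneg (PP_nonneg N s a hn _), norm_sub_rev]
    exact PP_le N hN s hs ha hn (sub_ne_zero.2 hy)
  have hmk : Measurable fun y : EN N => ‖x - y‖ ^ (-((N:ℝ) - 2*s)) := by fun_prop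
  have hne' := ae_restrict_of_ae (s := ball x0 r) hne
  -- f-term
  have j1 : IntegrableOn (fun y : EN N => ‖x - y‖ ^ (-((N:ℝ) - 2*s))) (ball x0 r) := by
    refine ⟨hmk.aestronglyMeasurable, ?_⟩
    rw [hasFiniteIntegral_iff_ofReal (Eventually.of_forall fun y => by simp only [Pi.zero_apply]; positivity)]
    exact (hD x).trans_lt ENNReal.ofReal_lt_top
  have j1' : ∫ y in ball x0 r, ‖x - y‖ ^ (-((N:ℝ) - 2*s)) ≤ D := by
    rw [integral_eq_lintegral_of_nonneg_ae (Eventually.of_forall fun y => by simp only [Pi.zero_apply]; positivity)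
      hmk.aestronglyMeasurable]
    exact ENNReal.toReal_le_of_le_ofReal hD0 (hD x)
  have b2 : |∫ y in ball x0 r, f y * φ y| ≤ Mf * (C' * D) := by
    rw [← Real.norm_eq_abs]
    refine (norm_integral_le_of_norm_le (j1.const_mul (Mf * C')) ?_).trans ?_
    · filter_upwards [hf, hne'] with y h1 h2
      rw [norm_mul, mul_assoc]
      exact mul_le_mul h1 (hφb y h2) (norm_nonneg _) hMf
    · rw [integral_const_mul, mul_assoc]
      gcongr
  -- V-term
  have hum := u_meas hu
  have em : AEStronglyMeasurable (fun y => ‖x - y‖ ^ (-((N:ℝ) - 2*s)) * |u y|) (volume.restrict (ball x0 r)) :=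
    hmk.aestronglyMeasurable.mul hum.norm.restrict
  have eQ : QQ N x0 r u ((N:ℝ) - 2*s) x = ∫⁻ y in ball x0 r, ENNReal.ofReal (‖x - y‖ ^ (-((N:ℝ) - 2*s)) * |u y|) := by
    unfold QQ
    refine lintegral_congr fun y => ?_
    rw [ENNReal.ofReal_mul (by positivity)]
  have nn : ∀ y, 0 ≤ ‖x - y‖ ^ (-((N:ℝ) - 2*s)) * |u y| := fun y => by positivity
  have j2 : IntegrableOn (fun y : EN N => ‖x - y‖ ^ (-((N:ℝ) - 2*s)) * |u y|) (ball x0 r) := by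
    refine ⟨em, ?_⟩
    rw [hasFiniteIntegral_iff_ofReal (Eventually.of_forall nn), ← eQ]
    exact lt_top_iff_ne_top.2 hQ
  have j2' : ∫ y in ball x0 r, ‖x - y‖ ^ (-((N:ℝ) - 2*s)) * |u y| = (QQ N x0 r u ((N:ℝ) - 2*s) x).toReal := by
    rw [integral_eq_lintegral_of_nonneg_ae (Eventually.of_forall nn) em, eQ]
  have b3 : |∫ y in ball x0 r, V y * u y * φ y| ≤ MV * C' * (QQ N x0 r u ((N:ℝ) - 2*s) x).toReal := by
    rw [← Real.norm_eq_abs, ← j2', ← integral_const_mul]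
    refine norm_integral_le_of_norm_le (j2.const_mul (MV * C')) ?_
    filter_upwards [hV, hne'] with y h1 h2
    rw [norm_mul, norm_mul]
    calc ‖V y‖ * ‖u y‖ * ‖φ y‖ ≤ MV * ‖u y‖ * (C' * ‖x - y‖ ^ (-((N:ℝ) - 2*s))) := by
          refine mul_le_mul (mul_le_mul_of_nonneg_right h1 (norm_nonneg _)) (hφb y h2) (norm_nonneg _) (by positivity)
      _ = _ := by rw [Real.norm_eq_abs]; ring
  rw [e1] at key
  have hq := ENNReal.ofReal_toReal hQ
  set q := (QQ N x0 r u ((N:ℝ) - 2*s) x).toReal with hqd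
  have hq0 : 0 ≤ q := ENNReal.toReal_nonneg
  rw [← hq, ← ENNReal.ofReal_mul (by positivity), ← ENNReal.ofReal_add]
  · refine ENNReal.ofReal_le_ofReal ?_
    set U := ∫ y, u y * (n ^ N * kk N s a (n • (y - x)))
    have hU : U = (∫ y, u y * kk N s a (y - x)) + (∫ y in ball x0 r, f y * φ y) -
      ∫ y in ball x0 r, V y * u y * φ y := by linarith
    have : |U| ≤ W * I0 + Mf * (C' * D) + MV * C' * q := by
      rw [hU]
      refine (abs_sub _ _).trans (add_le_add ((abs_add_le _ _).trans (add_le_add b1 b2)) b3)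
    refine this.trans ?_
    unfold AA
    rw [← hI0]
    clear_value C' I0 q U
    have p1 : 0 ≤ W * Mf := by positivity
    have p2 : 0 ≤ C' * D := by positivity
    have p3 : 0 ≤ MV * C' := by positivity
    have t1 := mul_nonneg p2 hI00
    have t2 := mul_nonneg p3 hI00
    have t3 := mul_nonneg p3 hMf
    have t4 := mul_nonneg p2 hq0
    have t5 := mul_nonneg hW0.le hq0
    nlinarith
  · have : 0 ≤ AA N s u Mf := add_nonneg hMf hI00
    positivity
  · positivity

open scoped ENNReal

/-- mollified indicator -/
def ww (N : ℕ) (s a : ℝ) (B : Set (EN N)) (n : ℝ) (y : EN N) : ℝ :=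
  ∫ x in B, n ^ N * kk N s a (n • (y - x))

theorem ww_eq (N : ℕ) (s a : ℝ) {B : Set (EN N)} (hB : MeasurableSet B) {n : ℝ} (hn : 1 ≤ n) (y : EN N) :
    ww N s a B n y = ∫ z, B.indicator (fun _ => (1:ℝ)) (y - n⁻¹ • z) * kk N s a z := by
  have hn0 : 0 < n := by linarith
  set G : EN N → ℝ := fun z => B.indicator (fun _ => (1:ℝ)) (y - n⁻¹ • z) * kk N s a z with hG
  unfold ww
  rw [← integral_indicator hB]
  have e1 : (fun x => B.indicator (fun x => n ^ N * kk N s a (n • (y - x))) x) =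
      fun x => (fun z => n ^ N * G (n • z)) (y - x) := by
    ext x
    simp only [hG]
    have : y - n⁻¹ • n • (y - x) = x := by rw [smul_smul, inv_mul_cancel₀ hn0.ne', one_smul]; abel
    rw [this]
    by_cases hx : x ∈ B <;> simp [hx]
  rw [e1, integral_sub_left_eq_self (fun z => n ^ N * G (n • z)) volume y, integral_const_mul,
    Measure.integral_comp_smul volume G n]
  simp only [finrank_euclideanSpace, Fintype.card_fin, smul_eq_mul]
  rw [abs_of_pos (by positivity)]
  field_simp

theorem ind_le {N : ℕ} (B : Set (EN N)) (x : EN N) : |B.indicator (fun _ => (1:ℝ)) x| ≤ 1 := by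
  by_cases hx : x ∈ B <;> simp [hx]

theorem ww_le (N : ℕ) (hN : 2 ≤ N) (s : ℝ) (hs : s ∈ Ioo (0:ℝ) 1) {a : ℝ} (ha : 0 < a)
    {B : Set (EN N)} (hB : MeasurableSet B) {n : ℝ} (hn : 1 ≤ n) (y : EN N) :
    |ww N s a B n y| ≤ ∫ z, kk N s a z := by
  rw [ww_eq N s a hB hn, ← Real.norm_eq_abs]
  refine norm_integral_le_of_norm_le (kk_integrable N hN s hs ha) (Eventually.of_forall fun z => ?_)
  rw [norm_mul, Real.norm_of_nonneg (kk_nonneg N hN s hs ha z)]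
  exact mul_le_of_le_one_left (kk_nonneg N hN s hs ha z) (ind_le _ _)

theorem ww_tendsto (N : ℕ) (hN : 2 ≤ N) (s : ℝ) (hs : s ∈ Ioo (0:ℝ) 1) {a : ℝ} (ha : 0 < a)
    (x' : EN N) (δ : ℝ) {y : EN N} (hy : y ∉ sphere x' δ) :
    Tendsto (fun n : ℕ => ww N s a (closedBall x' δ) ((n:ℝ) + 1) y) atTop
      (𝓝 ((closedBall x' δ).indicator (fun _ => ∫ z, kk N s a z) y)) := by
  have hB : MeasurableSet (closedBall x' δ) := measurableSet_closedBall
  have e : (closedBall x' δ).indicator (fun _ => ∫ z, kk N s a z) y =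
      ∫ z, (closedBall x' δ).indicator (fun _ => (1:ℝ)) y * kk N s a z := by
    rw [integral_const_mul]
    by_cases h : y ∈ closedBall x' δ <;> simp only [h, indicator_of_mem, indicator_of_notMem, not_false_eq_true, one_mul, zero_mul]
  rw [e]
  simp_rw [fun n : ℕ => ww_eq N s a hB (by linarith [(Nat.cast_nonneg n : (0:ℝ) ≤ n)] : (1:ℝ) ≤ (n:ℝ) + 1) y]
  have hkm := kk_meas N hN s hs ha
  refine tendsto_integral_of_dominated_convergence (kk N s a) ?_ (kk_integrable N hN s hs ha) ?_ ?_
  · intro n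
    refine Measurable.aestronglyMeasurable ?_
    refine Measurable.mul ?_ hkm
    exact (measurable_const.indicator hB).comp (by fun_prop : Measurable fun z : EN N => y - ((n:ℝ)+1)⁻¹ • z)
  · intro n
    refine Eventually.of_forall fun z => ?_
    rw [norm_mul, Real.norm_of_nonneg (kk_nonneg N hN s hs ha z)]
    exact mul_le_of_le_one_left (kk_nonneg N hN s hs ha z) (ind_le _ _)
  · refine Eventually.of_forall fun z => ?_
    refine Tendsto.mul_const _ ?_
    have t1 : Tendsto (fun n : ℕ => y - ((n:ℝ)+1)⁻¹ • z) atTop (𝓝 y) := by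
      have h := tendsto_one_div_add_atTop_nhds_zero_nat (𝕜 := ℝ)
      simp only [one_div] at h
      simpa using (tendsto_const_nhds (x := y)).sub (h.smul_const z)
    have hne : dist y x' ≠ δ := hy
    rcases lt_or_gt_of_ne hne with h | h
    · have hm : ∀ᶠ v in 𝓝 y, v ∈ ball x' δ := isOpen_ball.mem_nhds h
      refine tendsto_const_nhds.congr' ?_
      filter_upwards [t1.eventually hm] with n hn
      rw [indicator_of_mem (ball_subset_closedBall hn), indicator_of_mem (ball_subset_closedBall (mem_ball.2 h))]
    · have hm : ∀ᶠ v in 𝓝 y, v ∈ (closedBall x' δ)ᶜ :=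
        isClosed_closedBall.isOpen_compl.mem_nhds (by simpa using h)
      refine tendsto_const_nhds.congr' ?_
      filter_upwards [t1.eventually hm] with n hn
      rw [indicator_of_notMem hn, indicator_of_notMem (by simpa using h)]

theorem ww_bound (N : ℕ) (hN : 2 ≤ N) (s : ℝ) (hs : s ∈ Ioo (0:ℝ) 1) {a : ℝ} (ha : 0 < a)
    {X : ℝ} (hX : 0 ≤ X) : ∃ C : ℝ, 0 ≤ C ∧ ∀ B : Set (EN N), MeasurableSet B → B ⊆ closedBall 0 X →
      ∀ n : ℝ, 1 ≤ n → ∀ y, |ww N s a B n y| ≤ C * (1 / (1 + ‖y‖ ^ ((N:ℝ) + 2*s))) := by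
  obtain ⟨C, hC0, -, hC, -⟩ := kk_bound N hN s hs ha
  have hs0 := hs.1
  have hc0 := kk_int_pos N hN s hs ha
  set c0 := ∫ z, kk N s a z with hc0d
  set p : ℝ := (N:ℝ) + 2*s with hp
  have hp0 : 0 < p := by positivity
  set v := volume.real (closedBall (0:EN N) X) with hv
  have hv0 : 0 ≤ v := measureReal_nonneg
  have n1 : 0 ≤ c0 * (1 + (2*X+1) ^ p) := by positivity
  have n2 : 0 ≤ C * 2 ^ p * 2 * v := by positivity
  refine ⟨c0 * (1 + (2*X+1) ^ p) + C * 2 ^ p * 2 * v, by positivity, fun B hB hBX n hn y => ?_⟩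
  have hn0 : 0 < n := by linarith
  rw [mul_one_div, le_div_iff₀ (by positivity)]
  rcases le_total ‖y‖ (2*X+1) with hy | hy
  · have h1 := ww_le N hN s hs ha hB hn y
    have h2 : ‖y‖ ^ p ≤ (2*X+1) ^ p := Real.rpow_le_rpow (norm_nonneg _) hy hp0.le
    have := mul_le_mul h1 (add_le_add_right h2 1) (by positivity) hc0.le
    linarith
  · have hy1 : 1 ≤ ‖y‖ := by linarith
    have hy0 : 0 < ‖y‖ := by linarith
    have hb : ∀ x ∈ B, ‖n ^ N * kk N s a (n • (y - x))‖ ≤ C * (2 ^ p * ‖y‖ ^ (-p)) := by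
      intro x hx
      have hx1 : ‖x‖ ≤ X := by simpa using hBX hx
      have hz : ‖y‖ / 2 ≤ ‖y - x‖ := by
        have := norm_sub_norm_le y x
        linarith
      have hz0 : 0 < ‖y - x‖ := by linarith
      have hk := hC (n • (y - x)) (smul_ne_zero hn0.ne' (norm_pos_iff.1 hz0))
      rw [norm_mul, Real.norm_of_nonneg (kk_nonneg N hN s hs ha _), Real.norm_of_nonneg (by positivity)]
      rw [norm_smul, Real.norm_of_nonneg hn0.le, Real.mul_rpow hn0.le hz0.le] at hk
      have e1 : n ^ N * n ^ (-p) ≤ 1 := by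
        rw [← Real.rpow_natCast, ← Real.rpow_add hn0]
        exact Real.rpow_le_one_of_one_le_of_nonpos hn (by rw [hp]; linarith)
      have e2 : ‖y - x‖ ^ (-p) ≤ 2 ^ p * ‖y‖ ^ (-p) := by
        have : 2 ^ p * ‖y‖ ^ (-p) = (‖y‖/2) ^ (-p) := by
          rw [Real.div_rpow hy0.le (by norm_num), Real.rpow_neg (by norm_num : (0:ℝ) ≤ 2)]; field_simp
        rw [this]
        exact Real.rpow_le_rpow_of_nonpos (by positivity) hz (by linarith)
      calc n ^ N * kk N s a (n • (y - x)) ≤ n ^ N * (C * (n ^ (-p) * ‖y - x‖ ^ (-p))) := by gcongr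
        _ = C * ((n ^ N * n ^ (-p)) * ‖y - x‖ ^ (-p)) := by ring
        _ ≤ C * (1 * (2 ^ p * ‖y‖ ^ (-p))) := by gcongr
        _ = _ := by ring
    have hfin : volume B < ∞ := (measure_mono hBX).trans_lt measure_closedBall_lt_top
    have h1 := norm_setIntegral_le_of_norm_le_const (μ := volume) hfin hb
    have h2 : volume.real B ≤ v := measureReal_mono hBX measure_closedBall_lt_top.ne
    have h3 : |ww N s a B n y| ≤ C * (2 ^ p * ‖y‖ ^ (-p)) * v := by
      refine le_trans h1 ?_
      gcongr
    have h4 : ‖y‖ ^ (-p) * (1 + ‖y‖ ^ p) ≤ 2 := by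
      have h5 : 1 ≤ ‖y‖ ^ p := Real.one_le_rpow hy1 hp0.le
      rw [Real.rpow_neg hy0.le, inv_mul_le_iff₀ (by positivity)]
      linarith
    calc |ww N s a B n y| * (1 + ‖y‖ ^ p) ≤ C * (2 ^ p * ‖y‖ ^ (-p)) * v * (1 + ‖y‖ ^ p) := by gcongr
      _ = C * 2 ^ p * v * (‖y‖ ^ (-p) * (1 + ‖y‖ ^ p)) := by ring
      _ ≤ C * 2 ^ p * v * 2 := by gcongr
      _ ≤ _ := by linarith

theorem fub (N : ℕ) (hN : 2 ≤ N) (s : ℝ) (hs : s ∈ Ioo (0:ℝ) 1) {a : ℝ} (ha : 0 < a)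
    {u : EN N → ℝ} (hu : MemL1w N s u) {X : ℝ} (hX : 0 ≤ X) {B : Set (EN N)} (hB : MeasurableSet B)
    (hBX : B ⊆ closedBall 0 X) {n : ℝ} (hn : 1 ≤ n) :
    ∫ x in B, ∫ y, u y * (n ^ N * kk N s a (n • (y - x))) = ∫ y, u y * ww N s a B n y := by
  obtain ⟨W, hW0, hW⟩ := kk_n_bound N hN s hs ha hX
  have hfin : volume B < ∞ := (measure_mono hBX).trans_lt measure_closedBall_lt_top
  have hfm : IsFiniteMeasure (volume.restrict B) := ⟨by simpa using hfin⟩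
  have hum := u_meas hu
  have hkm := kk_meas N hN s hs ha
  rw [integral_integral_swap]
  · congr 1
    ext y
    rw [integral_const_mul, ww]
  · have h0 : Integrable (fun _ : EN N => n ^ N * W) (volume.restrict B) := integrable_const _
    refine (h0.mul_prod (u_abs_int hu)).mono' ?_ ?_
    · refine AEStronglyMeasurable.mul ?_ ?_
      · exact hum.comp_snd
      · refine Measurable.aestronglyMeasurable ?_
        exact (hkm.comp (by fun_prop : Measurable fun q : EN N × EN N => n • (q.2 - q.1))).const_mul _
    · have : (volume.restrict B).prod (volume : Measure (EN N)) = (volume.prod volume).restrict (B ×ˢ univ) := by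
        rw [← Measure.prod_restrict, Measure.restrict_univ]
      rw [this]
      refine (ae_restrict_mem (hB.prod MeasurableSet.univ)).mono ?_
      rintro ⟨x, y⟩ ⟨hx, -⟩
      have hx1 : ‖x‖ ≤ X := by simpa using hBX hx
      have hn0 : 0 < n := by linarith
      simp only [Function.uncurry, norm_mul, Real.norm_of_nonneg (kk_nonneg N hN s hs ha _),
        Real.norm_of_nonneg (by positivity : 0 ≤ n ^ N), Real.norm_eq_abs]
      calc |u y| * (n ^ N * kk N s a (n • (y - x))) ≤ |u y| * (n ^ N * (W * (1 / (1 + ‖y‖ ^ ((N:ℝ) + 2*s))))) := by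
            gcongr; exact hW n hn x y hx1
        _ = _ := by ring

theorem u_intOn {N : ℕ} {s : ℝ} (hs : s ∈ Ioo (0:ℝ) 1) {u : EN N → ℝ} (hu : MemL1w N s u) (x0 : EN N) (r : ℝ) :
    ∃ K : ℝ, 0 ≤ K ∧ (∀ x ∈ ball x0 r, 1 + ‖x‖ ^ ((N:ℝ) + 2*s) ≤ K) ∧ IntegrableOn u (ball x0 r) := by
  have hs0 := hs.1
  have hk : ∀ x ∈ ball x0 r, 1 + ‖x‖ ^ ((N:ℝ) + 2*s) ≤ 1 + (‖x0‖ + |r|) ^ ((N:ℝ) + 2*s) := by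
    intro x hx
    have h1 : ‖x - x0‖ < r := by simpa [dist_eq_norm] using hx
    have h2 : ‖x‖ ≤ ‖x - x0‖ + ‖x0‖ := by simpa using norm_add_le (x - x0) x0
    have := le_abs_self r
    gcongr
    linarith
  refine ⟨1 + (‖x0‖ + |r|) ^ ((N:ℝ) + 2*s), by positivity, hk, ?_⟩
  refine ((u_abs_int hu).integrableOn.const_mul (1 + (‖x0‖ + |r|) ^ ((N:ℝ) + 2*s))).mono' (u_meas hu).restrict ?_
  refine (ae_restrict_mem measurableSet_ball).mono fun x hx => ?_
  rw [← mul_div_assoc, le_div_iff₀ (by positivity), mul_comm]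
  exact mul_le_mul_of_nonneg_right (hk x hx) (abs_nonneg _)

theorem ball_ineq (N : ℕ) (hN : 2 ≤ N) (s : ℝ) (hs : s ∈ Ioo (0:ℝ) 1) {a : ℝ} (ha : 0 < a)
    {u : EN N → ℝ} (hu : MemL1w N s u) (F : EN N → ℝ≥0∞) (x' : EN N) {δ : ℝ} (hδ : 0 < δ)
    (hF : ∀ x ∈ closedBall x' δ, ∀ n : ℝ, 1 ≤ n →
      ENNReal.ofReal |∫ y, u y * (n ^ N * kk N s a (n • (y - x)))| ≤ F x) :
    ENNReal.ofReal ((∫ z, kk N s a z) * |∫ y in closedBall x' δ, u y|) ≤ ∫⁻ x in closedBall x' δ, F x := by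
  set B := closedBall x' δ with hBd
  set c0 := ∫ z, kk N s a z with hc0
  have hc0p : 0 < c0 := kk_int_pos N hN s hs ha
  have hB : MeasurableSet B := measurableSet_closedBall
  have hnt := EN_nontrivial N hN
  have hBX : B ⊆ closedBall 0 (‖x'‖ + δ) := closedBall_subset_closedBall' (by simp [add_comm])
  obtain ⟨C, hC0, hC⟩ := ww_bound N hN s hs ha (X := ‖x'‖ + δ) (by positivity)
  have hum := u_meas hu
  have hlim : Tendsto (fun n : ℕ => ∫ y, u y * ww N s a B ((n:ℝ) + 1) y) atTop
      (𝓝 (∫ y, u y * B.indicator (fun _ => c0) y)) := by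
    have h1 : ∀ n : ℕ, (1:ℝ) ≤ (n:ℝ) + 1 := fun n => by linarith [(Nat.cast_nonneg n : (0:ℝ) ≤ n)]
    refine tendsto_integral_of_dominated_convergence (fun y => C * (|u y| / (1 + ‖y‖ ^ ((N:ℝ) + 2*s)))) ?_
      ((u_abs_int hu).const_mul C) ?_ ?_
    · intro n
      refine hum.mul ?_
      unfold ww
      have hm : StronglyMeasurable (Function.uncurry fun (y x : EN N) => ((n:ℝ)+1) ^ N * kk N s a (((n:ℝ)+1) • (y - x))) :=
        (((kk_meas N hN s hs ha).comp (by fun_prop : Measurable fun q : EN N × EN N => ((n:ℝ)+1) • (q.1 - q.2))).const_mul _).stronglyMeasurable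
      exact (hm.integral_prod_right (ν := volume.restrict B)).aestronglyMeasurable
    · intro n
      refine Eventually.of_forall fun y => ?_
      rw [norm_mul, Real.norm_eq_abs, Real.norm_eq_abs]
      refine (mul_le_mul_of_nonneg_left (hC B hB hBX _ (h1 n) y) (abs_nonneg _)).trans (le_of_eq ?_)
      ring
    · have hsp : ∀ᵐ y : EN N, y ∉ sphere x' δ := measure_eq_zero_iff_ae_notMem.1 (Measure.addHaar_sphere volume x' δ)
      exact hsp.mono fun y hy => (ww_tendsto N hN s hs ha x' δ hy).const_mul _
  have e : ∫ y, u y * B.indicator (fun _ => c0) y = c0 * ∫ y in B, u y := by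
    rw [← integral_indicator hB, ← integral_const_mul]
    congr 1
    ext y
    by_cases h : y ∈ B <;> simp [h, mul_comm]
  rw [e] at hlim
  have hlim2 := (ENNReal.continuous_ofReal.tendsto _).comp ((continuous_abs.tendsto _).comp hlim)
  rw [abs_mul, abs_of_pos hc0p] at hlim2
  refine le_of_tendsto' hlim2 fun n => ?_
  have h1 : (1:ℝ) ≤ (n:ℝ) + 1 := by linarith [(Nat.cast_nonneg n : (0:ℝ) ≤ n)]
  simp only [Function.comp]
  rw [← fub N hN s hs ha hu (by positivity) hB hBX h1, ← Real.norm_eq_abs, ofReal_norm]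
  refine (enorm_integral_le_lintegral_enorm _).trans ?_
  refine setLIntegral_mono' hB fun x hx => ?_
  rw [← ofReal_norm, Real.norm_eq_abs]
  exact hF x hx _ h1

theorem QQ_meas {N : ℕ} {s : ℝ} {u : EN N → ℝ} (hu : MemL1w N s u) (x0 : EN N) (r β : ℝ) :
    Measurable (QQ N x0 r u β) := by
  have h1 := (u_meas hu).aemeasurable
  have e : QQ N x0 r u β = fun x => ∫⁻ y in ball x0 r, ENNReal.ofReal (‖x - y‖ ^ (-β)) * ENNReal.ofReal |h1.mk u y| := by
    ext x
    unfold QQ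
    refine lintegral_congr_ae ((ae_restrict_of_ae h1.ae_eq_mk).mono fun y hy => ?_)
    simp only [hy]
  rw [e]
  refine Measurable.lintegral_prod_right' (f := fun q : EN N × EN N => ENNReal.ofReal (‖q.1 - q.2‖ ^ (-β)) * ENNReal.ofReal |h1.mk u q.2|) ?_
  have m1 : Measurable (fun q : EN N × EN N => ENNReal.ofReal (‖q.1 - q.2‖ ^ (-β))) := by fun_prop
  refine m1.mul ?_
  exact (measurable_norm.comp (h1.measurable_mk.comp measurable_snd)).ennreal_ofReal

theorem QQ_fin (N : ℕ) (hN : 2 ≤ N) (s : ℝ) (hs : s ∈ Ioo (0:ℝ) 1) {u : EN N → ℝ} (hu : MemL1w N s u)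
    (x0 : EN N) (r : ℝ) {β : ℝ} (h0 : 0 ≤ β) (hβ : β < N) :
    ∫⁻ x in ball x0 r, QQ N x0 r u β x < ∞ := by
  obtain ⟨D, hD0, hD⟩ := riesz_sup N hN x0 r h0 hβ
  obtain ⟨K, -, -, hui⟩ := u_intOn hs hu x0 r
  have h1 := (u_meas hu).aemeasurable
  unfold QQ
  rw [lintegral_lintegral_swap]
  · calc ∫⁻ y in ball x0 r, ∫⁻ x in ball x0 r, ENNReal.ofReal (‖x - y‖ ^ (-β)) * ENNReal.ofReal |u y|
        ≤ ∫⁻ y in ball x0 r, ENNReal.ofReal D * ENNReal.ofReal |u y| := by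
          refine lintegral_mono fun y => ?_
          rw [lintegral_mul_const _ (by fun_prop)]
          gcongr
          simp_rw [fun x => norm_sub_rev x y]
          exact hD y
      _ < ∞ := by
          rw [lintegral_const_mul' _ _ ENNReal.ofReal_ne_top]
          refine ENNReal.mul_lt_top ENNReal.ofReal_lt_top ?_
          exact hui.abs.lintegral_lt_top
  · have m1 : Measurable (fun q : EN N × EN N => ENNReal.ofReal (‖q.1 - q.2‖ ^ (-β))) := by fun_prop
    refine AEMeasurable.mul (f := fun q : EN N × EN N => ENNReal.ofReal (‖q.1 - q.2‖ ^ (-β))) m1.aemeasurable ?_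
    exact (measurable_norm.comp_aemeasurable (h1.restrict.comp_snd)).ennreal_ofReal

theorem diff_ineq (N : ℕ) (hN : 2 ≤ N) {U : Set (EN N)} (hU : IsOpen U) {u : EN N → ℝ} (hu : IntegrableOn u U)
    {F : EN N → ℝ≥0∞} (hFm : Measurable F) (hF : ∫⁻ x in U, F x < ∞) {c0 : ℝ} (hc : 0 < c0)
    (h : ∀ x' : EN N, ∀ δ : ℝ, 0 < δ → closedBall x' δ ⊆ U →
      ENNReal.ofReal (c0 * |∫ y in closedBall x' δ, u y|) ≤ ∫⁻ x in closedBall x' δ, F x) :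
    ∀ᵐ x ∂(volume.restrict U), ENNReal.ofReal (c0 * |u x|) ≤ F x := by
  have hnt := EN_nontrivial N hN
  have i1 : Integrable (U.indicator u) := hu.integrable_indicator hU.measurableSet
  have i2 : Integrable (U.indicator fun x => (F x).toReal) := by
    rw [integrable_indicator_iff hU.measurableSet]
    exact integrable_toReal_of_lintegral_ne_top hFm.aemeasurable hF.ne
  have d1 := IsUnifLocDoublingMeasure.ae_tendsto_average volume i1.locallyIntegrable 1
  have d2 := IsUnifLocDoublingMeasure.ae_tendsto_average volume i2.locallyIntegrable 1
  have hfin : ∀ᵐ x ∂(volume.restrict U), F x < ∞ := ae_lt_top hFm hF.ne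
  filter_upwards [ae_restrict_of_ae d1, ae_restrict_of_ae d2, hfin, ae_restrict_mem hU.measurableSet] with x h1 h2 h3 hx
  have hδ : Tendsto (fun t : ℝ => t) (𝓝[>] (0:ℝ)) (𝓝[>] 0) := tendsto_id
  have hm : ∀ᶠ t in 𝓝[>] (0:ℝ), x ∈ closedBall x (1 * t) := by
    filter_upwards [self_mem_nhdsWithin] with t ht
    exact mem_closedBall_self (by simpa using (le_of_lt ht))
  have l1 := h1 (fun _ => x) (fun t => t) hδ hm
  have l2 := h2 (fun _ => x) (fun t => t) hδ hm
  rw [indicator_of_mem hx] at l1 l2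
  have l3 := ((continuous_abs.tendsto _).comp l1).const_mul c0
  have hle : c0 * |u x| ≤ (F x).toReal := by
    refine le_of_tendsto_of_tendsto l3 l2 ?_
    obtain ⟨ε, hε, hεU⟩ := Metric.isOpen_iff.1 hU x hx
    filter_upwards [Ioo_mem_nhdsGT hε] with t ht
    have hsub : closedBall x t ⊆ U := (closedBall_subset_ball ht.2).trans hεU
    have hh := h x t ht.1 hsub
    have hFt : ∫⁻ y in closedBall x t, F y ≠ ∞ := ((lintegral_mono_set hsub).trans_lt hF).ne
    simp only [Function.comp, setAverage_eq, smul_eq_mul]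
    have hv : 0 < volume.real (closedBall x t) :=
      ENNReal.toReal_pos (measure_closedBall_pos volume x ht.1).ne' measure_closedBall_lt_top.ne
    have e1 : ∫ y in closedBall x t, U.indicator u y = ∫ y in closedBall x t, u y :=
      setIntegral_congr_fun measurableSet_closedBall fun y hy => indicator_of_mem (hsub hy) _
    have e2 : ∫ y in closedBall x t, U.indicator (fun x => (F x).toReal) y = (∫⁻ y in closedBall x t, F y).toReal := by
      rw [← integral_toReal hFm.aemeasurable (ae_lt_top hFm hFt)]
      exact setIntegral_congr_fun measurableSet_closedBall fun y hy => indicator_of_mem (hsub hy) _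
    rw [e1, e2, abs_mul, abs_of_pos (by positivity)]
    rw [ENNReal.ofReal_le_iff_le_toReal hFt] at hh
    calc _ = (volume.real (closedBall x t))⁻¹ * (c0 * |∫ y in closedBall x t, u y|) := by ring
      _ ≤ _ := by gcongr
  exact (ENNReal.ofReal_le_iff_le_toReal h3.ne).2 hle

theorem base_ineq (N : ℕ) (hN : 2 ≤ N) (s : ℝ) (hs : s ∈ Ioo (0:ℝ) 1)
    (x0 : EN N) {r R : ℝ} (hr : 0 < r) (hR : R < r)
    (V : EN N → ℝ) (MV : ℝ) (hV : ∀ᵐ x ∂(volume.restrict (ball x0 r)), |V x| ≤ MV) :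
    ∃ C : ℝ, 0 < C ∧ ∀ f u : EN N → ℝ, ∀ Mf : ℝ, (∀ᵐ x ∂(volume.restrict (ball x0 r)), |f x| ≤ Mf) →
      MemL1w N s u → WSol N s x0 r V f u → ∀ᵐ x ∂(volume.restrict (ball x0 R)),
      ENNReal.ofReal |u x| ≤
        ENNReal.ofReal (C * AA N s u Mf) + ENNReal.ofReal C * QQ N x0 r u ((N:ℝ) - 2*s) x := by
  have hN' : (2:ℝ) ≤ N := by exact_mod_cast hN
  have ha : 0 < (r - R) / 2 := by linarith
  obtain ⟨C, hC0, hC⟩ := base_pt N hN s hs x0 (R := R) hr ha (by linarith) V MV hV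
  set a := (r - R) / 2 with had
  have hc0p : 0 < ∫ z, kk N s a z := kk_int_pos N hN s hs ha
  set c0 := ∫ z, kk N s a z with hc0
  refine ⟨C / c0, by positivity, fun f u Mf hf hu hw => ?_⟩
  set F : EN N → ℝ≥0∞ := fun x => ENNReal.ofReal (C * AA N s u Mf) + ENNReal.ofReal C * QQ N x0 r u ((N:ℝ) - 2*s) x with hF
  have hFm : Measurable F := measurable_const.add ((QQ_meas hu x0 r _).const_mul _)
  obtain ⟨K, -, -, hui⟩ := u_intOn hs hu x0 R
  have hFf : ∫⁻ x in ball x0 R, F x < ∞ := by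
    simp only [hF]
    rw [lintegral_add_left measurable_const, lintegral_const_mul' _ _ ENNReal.ofReal_ne_top]
    refine ENNReal.add_lt_top.2 ⟨?_, ENNReal.mul_lt_top ENNReal.ofReal_lt_top ?_⟩
    · simp only [lintegral_const, Measure.restrict_apply_univ]
      exact ENNReal.mul_lt_top ENNReal.ofReal_lt_top measure_ball_lt_top
    · refine (lintegral_mono_set (ball_subset_ball hR.le)).trans_lt ?_
      exact QQ_fin N hN s hs hu x0 r (by linarith [hs.2]) (by linarith [hs.1])
  have key := diff_ineq N hN isOpen_ball hui hFm hFf hc0p fun x' δ hδ hsub =>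
    ball_ineq N hN s hs ha hu F x' hδ fun x hx n hn => hC f u Mf hf hu hw x (hsub hx) n hn
  filter_upwards [key] with x hx
  have e : |u x| = c0⁻¹ * (c0 * |u x|) := by field_simp
  rw [e, ENNReal.ofReal_mul (by positivity)]
  refine (mul_le_mul_right hx _).trans (le_of_eq ?_)
  simp only [hF]
  rw [mul_add, ← ENNReal.ofReal_mul (by positivity), ← mul_assoc (ENNReal.ofReal c0⁻¹) (ENNReal.ofReal C), ← ENNReal.ofReal_mul (by positivity)]
  have e1 : c0⁻¹ * (C * AA N s u Mf) = C / c0 * AA N s u Mf := by ring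
  have e2 : c0⁻¹ * C = C / c0 := by ring
  rw [e1, e2]

open scoped ENNReal


theorem u_L1 {N : ℕ} {s : ℝ} (x0 : EN N) (r : ℝ) (hs : s ∈ Ioo (0:ℝ) 1) :
    ∃ K : ℝ, 0 ≤ K ∧ ∀ u : EN N → ℝ, MemL1w N s u →
      ∫⁻ y in ball x0 r, ENNReal.ofReal |u y| ≤ ENNReal.ofReal (K * ∫ y : EN N, |u y| / (1 + ‖y‖ ^ ((N:ℝ) + 2*s))) := by
  have hs0 := hs.1
  have hk : ∀ x ∈ ball x0 r, 1 + ‖x‖ ^ ((N:ℝ) + 2*s) ≤ 1 + (‖x0‖ + |r|) ^ ((N:ℝ) + 2*s) := by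
    intro x hx
    have h1 : ‖x - x0‖ < r := by simpa [dist_eq_norm] using hx
    have h2 : ‖x‖ ≤ ‖x - x0‖ + ‖x0‖ := by simpa using norm_add_le (x - x0) x0
    have := le_abs_self r
    gcongr
    linarith
  refine ⟨1 + (‖x0‖ + |r|) ^ ((N:ℝ) + 2*s), by positivity, fun u hu => ?_⟩
  have hi := (u_abs_int hu).const_mul (1 + (‖x0‖ + |r|) ^ ((N:ℝ) + 2*s))
  rw [← integral_const_mul, ofReal_integral_eq_lintegral_ofReal hi (Eventually.of_forall fun x => by positivity)]
  refine (setLIntegral_mono' measurableSet_ball fun x hx => ?_).trans (setLIntegral_le_lintegral (ball x0 r) _)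
  refine ENNReal.ofReal_le_ofReal ?_
  rw [← mul_div_assoc, le_div_iff₀ (by positivity), mul_comm]
  exact mul_le_mul_of_nonneg_right (hk x hx) (abs_nonneg _)

theorem kern1 {a b d α β γ : ℝ} (ha : 0 < a) (hd : 0 < d) (hab : a ≤ b) (hdab : d ≤ a + b)
    (h0 : 0 ≤ γ) (hα : γ ≤ α) :
    a ^ (-β) * b ^ (-α) ≤ 2 ^ γ * d ^ (-γ) * a ^ (-(α + β - γ)) := by
  have hb : 0 < b := ha.trans_le hab
  have e1 : b ^ (-α) = b ^ (-(α - γ)) * b ^ (-γ) := by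
    rw [← Real.rpow_add hb]; congr 1; ring
  have e2 : a ^ (-(α + β - γ)) = a ^ (-β) * a ^ (-(α - γ)) := by
    rw [← Real.rpow_add ha]; congr 1; ring
  have i1 : b ^ (-(α - γ)) ≤ a ^ (-(α - γ)) := Real.rpow_le_rpow_of_nonpos ha hab (by linarith)
  have i2 : b ^ (-γ) ≤ 2 ^ γ * d ^ (-γ) := by
    have : b ^ (-γ) ≤ (d/2) ^ (-γ) := Real.rpow_le_rpow_of_nonpos (by positivity) (by linarith) (by linarith)
    refine this.trans (le_of_eq ?_)
    rw [Real.div_rpow hd.le (by norm_num), Real.rpow_neg (by norm_num : (0:ℝ) ≤ 2), div_inv_eq_mul, mul_comm]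
  rw [e1, e2]
  calc a ^ (-β) * (b ^ (-(α - γ)) * b ^ (-γ)) ≤ a ^ (-β) * (a ^ (-(α - γ)) * (2 ^ γ * d ^ (-γ))) := by gcongr
    _ = _ := by ring

theorem kern2 {a b d α β γ : ℝ} (ha : 0 < a) (hb : 0 < b) (hd : 0 < d) (hdab : d ≤ a + b)
    (h0 : 0 ≤ γ) (hα : γ ≤ α) (hβ : γ ≤ β) :
    a ^ (-β) * b ^ (-α) ≤ 2 ^ γ * d ^ (-γ) * (a ^ (-(α + β - γ)) + b ^ (-(α + β - γ))) := by
  rw [mul_add]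
  rcases le_total a b with h | h
  · refine (kern1 ha hd h hdab h0 hα).trans (le_add_of_nonneg_right (by positivity))
  · have := kern1 (α := β) (β := α) hb hd h (by linarith) h0 hβ
    rw [mul_comm, add_comm β α] at this
    exact this.trans (le_add_of_nonneg_left (by positivity))

theorem comp_kern (N : ℕ) (hN : 2 ≤ N) (x0 : EN N) (r : ℝ) {α β γ : ℝ} (h0 : 0 ≤ γ) (hα : γ ≤ α) (hβ : γ ≤ β)
    (hδ : α + β - γ < N) : ∃ D : ℝ, 0 ≤ D ∧ ∀ x z : EN N, x ≠ z →
      ∫⁻ y in ball x0 r, ENNReal.ofReal (‖x - y‖ ^ (-β)) * ENNReal.ofReal (‖y - z‖ ^ (-α)) ≤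
        ENNReal.ofReal D * ENNReal.ofReal (‖x - z‖ ^ (-γ)) := by
  have hnt := EN_nontrivial N hN
  obtain ⟨D, hD0, hD⟩ := riesz_sup N hN x0 r (δ := α + β - γ) (by linarith) hδ
  refine ⟨2 ^ γ * (D + D), by positivity, fun x z hxz => ?_⟩
  have hd : 0 < ‖x - z‖ := norm_pos_iff.2 (sub_ne_zero.2 hxz)
  have hne : ∀ w : EN N, ∀ᵐ y ∂(volume.restrict (ball x0 r)), y ≠ w := fun w =>
    ae_restrict_of_ae (Measure.ae_ne volume w)
  calc ∫⁻ y in ball x0 r, ENNReal.ofReal (‖x - y‖ ^ (-β)) * ENNReal.ofReal (‖y - z‖ ^ (-α))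
      ≤ ∫⁻ y in ball x0 r, ENNReal.ofReal (2 ^ γ * ‖x - z‖ ^ (-γ)) *
          (ENNReal.ofReal (‖x - y‖ ^ (-(α + β - γ))) + ENNReal.ofReal (‖z - y‖ ^ (-(α + β - γ)))) := by
        refine lintegral_mono_ae ?_
        filter_upwards [hne x, hne z] with y hyx hyz
        rw [← ENNReal.ofReal_mul (by positivity), ← ENNReal.ofReal_add (by positivity) (by positivity),
          ← ENNReal.ofReal_mul (by positivity), norm_sub_rev z y]
        refine ENNReal.ofReal_le_ofReal (kern2 (norm_pos_iff.2 (sub_ne_zero.2 hyx.symm))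
          (norm_pos_iff.2 (sub_ne_zero.2 hyz)) hd (norm_sub_le_norm_sub_add_norm_sub x y z) h0 hα hβ)
    _ = ENNReal.ofReal (2 ^ γ * ‖x - z‖ ^ (-γ)) * ((∫⁻ y in ball x0 r, ENNReal.ofReal (‖x - y‖ ^ (-(α + β - γ))))
          + ∫⁻ y in ball x0 r, ENNReal.ofReal (‖z - y‖ ^ (-(α + β - γ)))) := by
        rw [lintegral_const_mul' _ _ ENNReal.ofReal_ne_top, lintegral_add_left (by fun_prop)]
    _ ≤ ENNReal.ofReal (2 ^ γ * ‖x - z‖ ^ (-γ)) * (ENNReal.ofReal D + ENNReal.ofReal D) :=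
        mul_le_mul_right (add_le_add (hD x) (hD z)) _
    _ = _ := by
        rw [← ENNReal.ofReal_add hD0 hD0, ← ENNReal.ofReal_mul (by positivity), ← ENNReal.ofReal_mul (by positivity)]
        congr 1; ring

theorem QQ_comp (N : ℕ) (hN : 2 ≤ N) (s : ℝ) (x0 : EN N) (r : ℝ) {α β γ : ℝ} (h0 : 0 ≤ γ) (hα : γ ≤ α) (hβ : γ ≤ β)
    (hδ : α + β - γ < N) : ∃ D : ℝ, 0 ≤ D ∧ ∀ u : EN N → ℝ, MemL1w N s u → ∀ x : EN N,
      ∫⁻ y in ball x0 r, ENNReal.ofReal (‖x - y‖ ^ (-β)) * QQ N x0 r u α y ≤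
        ENNReal.ofReal D * QQ N x0 r u γ x := by
  have hnt := EN_nontrivial N hN
  obtain ⟨D, hD0, hD⟩ := comp_kern N hN x0 r h0 hα hβ hδ
  refine ⟨D, hD0, fun u hu x => ?_⟩
  have h1 := (u_meas hu).aemeasurable
  calc ∫⁻ y in ball x0 r, ENNReal.ofReal (‖x - y‖ ^ (-β)) * QQ N x0 r u α y
      = ∫⁻ y in ball x0 r, ∫⁻ z in ball x0 r, ENNReal.ofReal (‖x - y‖ ^ (-β)) *
          ENNReal.ofReal (‖y - z‖ ^ (-α)) * ENNReal.ofReal |u z| := by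
        refine lintegral_congr fun y => ?_
        unfold QQ
        rw [← lintegral_const_mul' _ _ ENNReal.ofReal_ne_top]
        simp_rw [mul_assoc]
    _ = ∫⁻ z in ball x0 r, ∫⁻ y in ball x0 r, ENNReal.ofReal (‖x - y‖ ^ (-β)) *
          ENNReal.ofReal (‖y - z‖ ^ (-α)) * ENNReal.ofReal |u z| := by
        refine lintegral_lintegral_swap ?_
        have m1 : Measurable (fun q : EN N × EN N => ENNReal.ofReal (‖x - q.1‖ ^ (-β)) * ENNReal.ofReal (‖q.1 - q.2‖ ^ (-α))) := by fun_prop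
        refine AEMeasurable.mul (f := fun q : EN N × EN N => ENNReal.ofReal (‖x - q.1‖ ^ (-β)) * ENNReal.ofReal (‖q.1 - q.2‖ ^ (-α))) m1.aemeasurable ?_
        exact (measurable_norm.comp_aemeasurable (h1.restrict.comp_snd)).ennreal_ofReal
    _ ≤ ∫⁻ z in ball x0 r, ENNReal.ofReal D * (ENNReal.ofReal (‖x - z‖ ^ (-γ)) * ENNReal.ofReal |u z|) := by
        refine lintegral_mono_ae ?_
        filter_upwards [ae_restrict_of_ae (Measure.ae_ne volume x)] with z hz
        rw [lintegral_mul_const' _ _ ENNReal.ofReal_ne_top, ← mul_assoc]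
        exact mul_le_mul_left (hD x z hz.symm) _
    _ = _ := by
        rw [lintegral_const_mul' _ _ ENNReal.ofReal_ne_top]; rfl

/-- The bootstrap property. -/
def PB (N : ℕ) (s : ℝ) (x0 : EN N) (r : ℝ) (V : EN N → ℝ) (β : ℝ) : Prop :=
  ∀ R : ℝ, R < r → ∃ C : ℝ, 0 < C ∧ ∀ f u : EN N → ℝ, ∀ Mf : ℝ, (∀ᵐ x ∂(volume.restrict (ball x0 r)), |f x| ≤ Mf) →
      MemL1w N s u → WSol N s x0 r V f u → ∀ᵐ x ∂(volume.restrict (ball x0 R)),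
      ENNReal.ofReal |u x| ≤
        ENNReal.ofReal (C * AA N s u Mf) + ENNReal.ofReal C * QQ N x0 r u β x

theorem PB_step (N : ℕ) (hN : 2 ≤ N) (s : ℝ) (hs : s ∈ Ioo (0:ℝ) 1)
    (x0 : EN N) {r : ℝ} (hr : 0 < r)
    (V : EN N → ℝ) (hB : PB N s x0 r V ((N:ℝ) - 2*s)) {β γ : ℝ} (h0 : 0 ≤ γ) (hγβ : γ ≤ β) (hβ : β ≤ (N:ℝ) - 2*s)
    (hδ : (N:ℝ) - 2*s + β - γ < N) (hP : PB N s x0 r V β) : PB N s x0 r V γ := by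
  intro R hR
  have hs0 := hs.1
  obtain ⟨C1, hC1, H1⟩ := hP R hR
  obtain ⟨C2, hC2, H2⟩ := hB ((R + r)/2) (by linarith)
  obtain ⟨D1, hD1, HD1⟩ := riesz_sup N hN x0 r (δ := β) (by linarith) (by linarith)
  obtain ⟨D, hD, HD⟩ := QQ_comp N hN s x0 r (α := (N:ℝ) - 2*s) h0 (by linarith) hγβ hδ
  obtain ⟨K, hK, HK⟩ := u_L1 (s := s) x0 r hs
  have hc : 0 < (r - R)/2 := by linarith
  set c := ((r - R)/2) ^ (-β) with hcd
  have hc0 : 0 < c := Real.rpow_pos_of_pos hc _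
  refine ⟨C1 + C1 * (C2 * D1 + c * K) + C1 * (C2 * D), by positivity, fun f u Mf hf hu hw => ?_⟩
  have hMf : 0 ≤ Mf := bd_nonneg hr hf
  have hI : 0 ≤ ∫ y : EN N, |u y| / (1 + ‖y‖ ^ ((N:ℝ) + 2*s)) := integral_nonneg fun y => by positivity
  set A := AA N s u Mf with hA
  have hA0 : 0 ≤ A := add_nonneg hMf hI
  have hIA : ∫ y : EN N, |u y| / (1 + ‖y‖ ^ ((N:ℝ) + 2*s)) ≤ A := le_add_of_nonneg_left hMf
  have hb := (ae_restrict_iff' measurableSet_ball).1 (H2 f u Mf hf hu hw)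
  filter_upwards [H1 f u Mf hf hu hw, ae_restrict_mem measurableSet_ball] with x hx hxR
  have hQ : QQ N x0 r u β x ≤ ENNReal.ofReal (D1 * (C2 * A)) + ENNReal.ofReal (C2 * D) * QQ N x0 r u γ x
      + ENNReal.ofReal (c * (K * A)) := by
    calc QQ N x0 r u β x ≤ ∫⁻ y in ball x0 r, (ENNReal.ofReal (‖x - y‖ ^ (-β)) * ENNReal.ofReal (C2 * A)
            + ENNReal.ofReal C2 * (ENNReal.ofReal (‖x - y‖ ^ (-β)) * QQ N x0 r u ((N:ℝ) - 2*s) y))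
            + ENNReal.ofReal c * ENNReal.ofReal |u y| := by
          unfold QQ
          refine lintegral_mono_ae ((ae_restrict_of_ae hb).mono fun y hy => ?_)
          by_cases h : y ∈ ball x0 ((R + r)/2)
          · refine le_add_right ?_
            refine (mul_le_mul_right (hy h) _).trans (le_of_eq ?_)
            rw [mul_add, mul_left_comm (ENNReal.ofReal C2)]
            rfl
          · refine le_add_left ?_
            refine mul_le_mul_left (ENNReal.ofReal_le_ofReal ?_) _
            refine Real.rpow_le_rpow_of_nonpos hc ?_ (by linarith)
            have h1 : (R + r)/2 ≤ dist y x0 := by simpa using h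
            have h2 : dist x x0 < R := hxR
            have h3 := dist_triangle y x x0
            rw [dist_comm y x, dist_eq_norm x y] at h3
            linarith
      _ = (∫⁻ y in ball x0 r, ENNReal.ofReal (‖x - y‖ ^ (-β))) * ENNReal.ofReal (C2 * A)
            + ENNReal.ofReal C2 * (∫⁻ y in ball x0 r, ENNReal.ofReal (‖x - y‖ ^ (-β)) * QQ N x0 r u ((N:ℝ) - 2*s) y)
            + ENNReal.ofReal c * ∫⁻ y in ball x0 r, ENNReal.ofReal |u y| := by
          have m0 : Measurable fun y : EN N => ENNReal.ofReal (‖x - y‖ ^ (-β)) := by fun_prop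
          have m1 : Measurable fun y : EN N => ENNReal.ofReal (‖x - y‖ ^ (-β)) * ENNReal.ofReal (C2 * A) := m0.mul_const _
          have m2 : Measurable fun y : EN N => ENNReal.ofReal C2 * (ENNReal.ofReal (‖x - y‖ ^ (-β)) * QQ N x0 r u ((N:ℝ) - 2*s) y) :=
            (m0.mul (QQ_meas hu x0 r _)).const_mul _
          have m3 : Measurable fun y : EN N => ENNReal.ofReal (‖x - y‖ ^ (-β)) * ENNReal.ofReal (C2 * A)
              + ENNReal.ofReal C2 * (ENNReal.ofReal (‖x - y‖ ^ (-β)) * QQ N x0 r u ((N:ℝ) - 2*s) y) := m1.add m2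
          rw [lintegral_add_left m3, lintegral_add_left m1, lintegral_mul_const' _ _ ENNReal.ofReal_ne_top,
            lintegral_const_mul' _ _ ENNReal.ofReal_ne_top, lintegral_const_mul' _ _ ENNReal.ofReal_ne_top]
      _ ≤ ENNReal.ofReal D1 * ENNReal.ofReal (C2 * A) + ENNReal.ofReal C2 * (ENNReal.ofReal D * QQ N x0 r u γ x)
            + ENNReal.ofReal c * ENNReal.ofReal (K * A) := by
          refine add_le_add (add_le_add (mul_le_mul_left (HD1 x) _) (mul_le_mul_right (HD u hu x) _)) (mul_le_mul_right ((HK u hu).trans ?_) _)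
          exact ENNReal.ofReal_le_ofReal (mul_le_mul_of_nonneg_left hIA hK)
      _ = _ := by
          rw [← ENNReal.ofReal_mul hD1, ← ENNReal.ofReal_mul hc0.le, ← mul_assoc, ← mul_assoc (ENNReal.ofReal C2), ← ENNReal.ofReal_mul hC2.le]
  calc ENNReal.ofReal |u x| ≤ ENNReal.ofReal (C1 * A) + ENNReal.ofReal C1 * QQ N x0 r u β x := hx
    _ ≤ ENNReal.ofReal (C1 * A) + ENNReal.ofReal C1 * (ENNReal.ofReal (D1 * (C2 * A)) + ENNReal.ofReal (C2 * D) * QQ N x0 r u γ x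
      + ENNReal.ofReal (c * (K * A))) := add_le_add le_rfl (mul_le_mul_right hQ _)
    _ = ENNReal.ofReal ((C1 + C1 * (C2 * D1 + c * K)) * A) + ENNReal.ofReal (C1 * (C2 * D)) * QQ N x0 r u γ x := by
        have e : (C1 + C1 * (C2 * D1 + c * K)) * A = C1 * A + C1 * (D1 * (C2 * A)) + C1 * (c * (K * A)) := by ring
        rw [e, ENNReal.ofReal_add (by positivity) (by positivity), ENNReal.ofReal_add (by positivity) (by positivity),
          ENNReal.ofReal_mul (p := C1) (q := D1 * (C2 * A)) hC1.le, ENNReal.ofReal_mul (p := C1) (q := c * (K * A)) hC1.le,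
          ENNReal.ofReal_mul (p := C1) (q := C2 * D) hC1.le]
        ring
    _ ≤ _ := by
        refine add_le_add (ENNReal.ofReal_le_ofReal (mul_le_mul_of_nonneg_right ?_ hA0)) (mul_le_mul_left (ENNReal.ofReal_le_ofReal ?_) _)
        · exact le_add_of_nonneg_right (by positivity)
        · exact le_add_of_nonneg_left (by positivity)

theorem PB_zero (N : ℕ) (hN : 2 ≤ N) (s : ℝ) (hs : s ∈ Ioo (0:ℝ) 1)
    (x0 : EN N) {r : ℝ} (hr : 0 < r)
    (V : EN N → ℝ) (MV : ℝ) (hV : ∀ᵐ x ∂(volume.restrict (ball x0 r)), |V x| ≤ MV) : PB N s x0 r V 0 := by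
  have hs0 := hs.1
  have hs1 := hs.2
  have hN' : (2:ℝ) ≤ N := by exact_mod_cast hN
  have hB : PB N s x0 r V ((N:ℝ) - 2*s) := fun R hR => base_ineq N hN s hs x0 hr hR V MV hV
  have key : ∀ j : ℕ, PB N s x0 r V (max 0 ((N:ℝ) - 2*s - j * s)) := by
    intro j
    induction j with
    | zero =>
      have e : max 0 ((N:ℝ) - 2*s - (0:ℕ) * s) = (N:ℝ) - 2*s := by
        rw [max_eq_right] <;> push_cast <;> linarith
      rw [e]; exact hB
    | succ j ih =>
      have hj : 0 ≤ (j:ℝ) * s := by positivity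
      have e : (N:ℝ) - 2*s - ((j+1:ℕ):ℝ) * s = (N:ℝ) - 2*s - j * s - s := by push_cast; ring
      rw [e]
      refine PB_step N hN s hs x0 hr V hB (le_max_left _ _) ?_ ?_ ?_ ih
      · exact max_le_max le_rfl (by linarith)
      · exact max_le (by linarith) (by linarith)
      · have h1 := le_max_left 0 ((N:ℝ) - 2*s - j * s - s)
        have h2 := le_max_right 0 ((N:ℝ) - 2*s - j * s - s)
        rcases max_cases 0 ((N:ℝ) - 2*s - j * s) with h | h <;> linarith [h.1]
  obtain ⟨j, hj⟩ := exists_nat_gt (((N:ℝ) - 2*s) / s)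
  have h := key j
  rwa [max_eq_left] at h
  rw [div_lt_iff₀ hs0] at hj
  linarith

theorem main_est (N : ℕ) (hN : 2 ≤ N) (s : ℝ) (hs : s ∈ Ioo (0:ℝ) 1)
    (x0 : EN N) {r R : ℝ} (hr : 0 < r) (hR : R < r)
    (V : EN N → ℝ) (MV : ℝ) (hV : ∀ᵐ x ∂(volume.restrict (ball x0 r)), |V x| ≤ MV) :
    ∃ C : ℝ, 0 < C ∧ ∀ f u : EN N → ℝ, ∀ Mf : ℝ, (∀ᵐ x ∂(volume.restrict (ball x0 r)), |f x| ≤ Mf) →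
      MemL1w N s u → WSol N s x0 r V f u → ∀ᵐ x ∂(volume.restrict (ball x0 R)),
      |u x| ≤ C * AA N s u Mf := by
  obtain ⟨C, hC, H⟩ := PB_zero N hN s hs x0 hr V MV hV R hR
  obtain ⟨K, hK, HK⟩ := u_L1 (s := s) x0 r hs
  refine ⟨C + C * K, by positivity, fun f u Mf hf hu hw => ?_⟩
  have hMf : 0 ≤ Mf := bd_nonneg hr hf
  have hI : 0 ≤ ∫ y : EN N, |u y| / (1 + ‖y‖ ^ ((N:ℝ) + 2*s)) := integral_nonneg fun y => by positivity
  set A := AA N s u Mf with hA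
  have hA0 : 0 ≤ A := add_nonneg hMf hI
  have hIA : ∫ y : EN N, |u y| / (1 + ‖y‖ ^ ((N:ℝ) + 2*s)) ≤ A := le_add_of_nonneg_left hMf
  filter_upwards [H f u Mf hf hu hw] with x hx
  have hQ : QQ N x0 r u 0 x ≤ ENNReal.ofReal (K * A) := by
    have : QQ N x0 r u 0 x = ∫⁻ y in ball x0 r, ENNReal.ofReal |u y| := by simp [QQ]
    rw [this]
    exact (HK u hu).trans (ENNReal.ofReal_le_ofReal (mul_le_mul_of_nonneg_left hIA hK))
  have h2 := hx.trans (add_le_add le_rfl (mul_le_mul_right hQ _))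
  rw [← ENNReal.ofReal_mul hC.le, ← ENNReal.ofReal_add (by positivity) (by positivity),
    ENNReal.ofReal_le_ofReal_iff (by positivity)] at h2
  refine h2.trans (le_of_eq ?_)
  ring

/-- Proposition 6.1 (Appendix A): local `L^∞` bound for distributional
solutions of `(-Δ)^s u + V u = f` in a ball, with a constant depending only on
`N, s, V, r, ρ`. -/
theorem local_Linfty_estimate
    (N : ℕ) (hN : 2 ≤ N) (s : ℝ) (hs : s ∈ Ioo (0:ℝ) 1)
    (x0 : EN N) (r ρ : ℝ) (hr : 0 < r) (hρ : ρ ∈ Ioo (0:ℝ) 1)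
    (V : EN N → ℝ) (hVm : AEMeasurable V)
    (MV : ℝ) (hV : ∀ᵐ x ∂(volume.restrict (ball x0 r)), |V x| ≤ MV) :
    ∃ C : ℝ, 0 < C ∧
      ∀ f u : EN N → ℝ, AEMeasurable f →
        ∀ Mf : ℝ, (∀ᵐ x ∂(volume.restrict (ball x0 r)), |f x| ≤ Mf) →
        MemL1w N s u →
        (∀ φ : EN N → ℝ, ContDiff ℝ (⊤ : ℕ∞) φ → HasCompactSupport φ →
          tsupport φ ⊆ ball x0 r →
          ∀ g : EN N → ℝ, (∀ x, HasFracLap N s φ x (g x)) →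
            (∫ x, u x * g x) + (∫ x in ball x0 r, V x * u x * φ x) =
              ∫ x in ball x0 r, f x * φ x) →
        ∀ᵐ x ∂(volume.restrict (ball x0 (ρ * r))),
          |u x| ≤ C * (Mf + ∫ y : EN N, |u y| / (1 + ‖y‖ ^ ((N:ℝ) + 2*s))) := by
  have hR : ρ * r < r := by nlinarith [hρ.2]
  obtain ⟨C, hC, H⟩ := main_est N hN s hs x0 hr hR V MV hV
  exact ⟨C, hC, fun f u _ Mf hf hu hw => H f u Mf hf hu hw⟩
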